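/- Let G be a group scheme over a base scheme S with connected fibres, and suppose G → S is quasi-separated and flat. Then G → S is separated. -/

import Mathlib

/-!
Common infrastructure for formalizing "Néron models of jacobians over base schemes of
dimension greater than 1" (semistable morphisms, strata, dual graphs, alignment,
specialisation maps, Cartier/Weil divisors, Picard data, Néron models).

Notes on design choices (Mathlib has no algebraic spaces, no Picard functor, no strict
henselisation and no excellent rings):
* Algebraic spaces are replaced by schemes throughout.
* The label of a point of a semistable morphism over a strictly henselian local base is
  taken in the local ring itself (which agrees with the strict henselisation there), and
  alignment over a general base is defined via base change to arbitrary strictly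
  henselian Noetherian local test rings (which is equivalent to the definition via
  geometric points, since the strict henselisations are among such test rings).
* Excellence of the base is beyond current Mathlib and is omitted from hypotheses.
-/

open AlgebraicGeometry CategoryTheory CategoryTheory.Limits

universe u

noncomputable section

namespace NeronSemistable

/-! ### Local properties of morphisms of schemes -/

/-- `f` is smooth at the point `x` if it is smooth on an open neighbourhood of `x`. -/
def SmoothAtPt {X S : Scheme.{u}} (f : X ⟶ S) (x : X) : Prop :=
  ∃ U : X.Opens, x ∈ U ∧ IsSmooth (U.ι ≫ f)

/-- `f` is étale at the point `x` if it is étale on an open neighbourhood of `x`. -/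
def EtaleAtPt {X S : Scheme.{u}} (f : X ⟶ S) (x : X) : Prop :=
  ∃ U : X.Opens, x ∈ U ∧ IsEtale (U.ι ≫ f)

/-- `f` is flat at `x` if the induced map of stalks is flat. -/
def FlatAtPt {X S : Scheme.{u}} (f : X ⟶ S) (x : X) : Prop :=
  letI := (f.stalkMap x).hom.toAlgebra
  Module.Flat (S.presheaf.stalk (f.base x)) (X.presheaf.stalk x)

/-- A morphism of schemes is flat if it is flat at every point. -/
def SchemeFlat {X S : Scheme.{u}} (f : X ⟶ S) : Prop := ∀ x : X, FlatAtPt f x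

/-- The non-smooth locus of a morphism, as a set of points. -/
def NonSmoothLocus {X S : Scheme.{u}} (f : X ⟶ S) : Set X := {x | ¬ SmoothAtPt f x}

/-! ### Fibres -/

/-- The scheme-theoretic fibre `X_s` of `f : X ⟶ S` over `s ∈ S`. -/
def fiberScheme {X S : Scheme.{u}} (f : X ⟶ S) (s : S) : Scheme.{u} :=
  pullback f (S.fromSpecResidueField s)

/-- The projection from the fibre `X_s` to `X`. -/
def fiberι {X S : Scheme.{u}} (f : X ⟶ S) (s : S) : fiberScheme f s ⟶ X :=
  pullback.fst f (S.fromSpecResidueField s)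

/-- The structure morphism of the fibre `X_s` to the spectrum of the residue field. -/
def fiberRes {X S : Scheme.{u}} (f : X ⟶ S) (s : S) :
    fiberScheme f s ⟶ Spec (S.residueField s) :=
  pullback.snd f (S.fromSpecResidueField s)

/-- `f : X ⟶ S` has geometrically connected fibres. -/
def GeomConnFibers {X S : Scheme.{u}} (f : X ⟶ S) : Prop :=
  ∀ (K : Type u) [Field K] [IsAlgClosed K] (g : Spec (CommRingCat.of K) ⟶ S),
    ConnectedSpace ↑(pullback f g)

/-- A subset `T` of a scheme `Z` over (the spectrum of) a field object `k` is geometrically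
irreducible if its preimage in `Z ×_k K` is irreducible for every field extension `K` of `k`. -/
def GeomIrreducibleOver (k : CommRingCat.{u}) {Z : Scheme.{u}} (g : Z ⟶ Spec k)
    (T : Set Z) : Prop :=
  ∀ (K : Type u) [Field K] (ψ : k ⟶ CommRingCat.of K),
    IsIrreducible ((pullback.fst g (Spec.map ψ)).base ⁻¹' T)

/-! ### Standard local models `Spec R[x₁,…,xₙ]/(x₁⋯x_l − b)` and semistable morphisms -/

open MvPolynomial in
/-- The ring `R[x₁,…,xₙ]/(x₁⋯x_l − b)`. -/
abbrev stdRing (R : Type u) [CommRing R] (n l : ℕ) (b : R) : Type u :=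
  MvPolynomial (Fin n) R ⧸
    Ideal.span {(∏ i : Fin n, if (i : ℕ) < l then X i else 1) - C b}

/-- The standard local model as a scheme. -/
def stdScheme (R : Type u) [CommRing R] (n l : ℕ) (b : R) : Scheme.{u} :=
  Spec (CommRingCat.of (stdRing R n l b))

/-- The structure morphism of the standard local model. -/
def stdSpec (R : CommRingCat.{u}) (n l : ℕ) (b : R) : stdScheme ↥R n l b ⟶ Spec R :=
  Spec.map (CommRingCat.ofHom (algebraMap ↥R (stdRing ↥R n l b)))

open MvPolynomial in
/-- The class of the coordinate `x_i` in the standard model. -/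
def stdCoord (R : Type u) [CommRing R] (n l : ℕ) (b : R) (i : Fin n) : stdRing R n l b :=
  Ideal.Quotient.mk _ (X i)

/-- The data of a commutative diagram exhibiting `f` étale-locally at `x` as a standard
semistable model `Spec R[x₁,…,xₙ]/(x₁⋯x_l − b)`, as in the definition of a semistable
morphism. -/
structure ChartData {X S : Scheme.{u}} (f : X ⟶ S) (x : X) where
  R : CommRingCat.{u}
  n : ℕ
  l : ℕ
  hln : l ≤ n
  b : ↥R
  etS : Spec R ⟶ S
  etS_etale : IsEtale etS
  s' : ↑(Spec R)
  hs' : etS.base s' = f.base x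
  U : Scheme.{u}
  U_conn : ConnectedSpace ↑U
  gX : U ⟶ X
  gX_etale : IsEtale gX
  x' : ↑U
  hx' : gX.base x' = x
  gT : U ⟶ stdScheme ↥R n l b
  gT_etale : IsEtale gT
  comm : gT ≫ stdSpec R n l b ≫ etS = gX ≫ f

/-- A morphism is semistable if it is proper with geometrically connected fibres and admits
standard semistable charts étale-locally at every point. -/
def IsSemistable {X S : Scheme.{u}} (f : X ⟶ S) : Prop :=
  IsProper f ∧ GeomConnFibers f ∧ ∀ x : X, Nonempty (ChartData f x)

/-! ### Local rings: regularity, strict henselianity -/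

/-- The closed point of `Spec R` for a local ring `R` (with the local-ring witness passed
explicitly). -/
def closedPt (R : CommRingCat.{u}) (h : IsLocalRing ↥R) : ↑(Spec R) :=
  (@IsLocalRing.closedPoint ↥R _ h : PrimeSpectrum ↥R)

/-- A commutative ring is strictly henselian local if it is a henselian local ring with
separably closed residue field. -/
structure StrictlyHenselianLocal (A : Type u) [CommRing A] : Prop where
  toIsLocalRing : IsLocalRing A
  henselian : HenselianLocalRing A
  sepClosedResidue : @IsSepClosed (@IsLocalRing.ResidueField A _ toIsLocalRing)
      (@IsLocalRing.ResidueField.field A _ toIsLocalRing)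

/-- A Noetherian local ring is regular if its maximal ideal is generated by
`dim R` many elements. -/
def IsRegularLocal (A : Type u) [CommRing A] : Prop :=
  IsNoetherianRing A ∧ ∃ (h : IsLocalRing A) (s : Finset A),
    Ideal.span (s : Set A) = @IsLocalRing.maximalIdeal A _ h ∧
    (s.card : WithBot (WithTop ℕ)) = ringKrullDim A

/-- A scheme is regular if all its local rings are regular (and it is locally Noetherian). -/
def IsRegularScheme (X : Scheme.{u}) : Prop :=
  IsLocallyNoetherian X ∧ ∀ x : X, IsRegularLocal ↥(X.presheaf.stalk x)

/-! ### Labels of points of semistable morphisms over a local base -/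

/-- Over an affine base `Spec R`, the point `x` (of the non-smooth locus of its fibre) has
label `(b)`, `b ∈ R`, if there is a local chart
`U ⟶ Spec R[x₁,…,xₙ]/(x₁⋯x_l − b)` at `x` (with the coordinates `x₁,…,x_l` contained in
the prime ideal of the image of `x`).  Over a strictly henselian local ring this agrees
with the usual label in the strict henselisation. -/
def HasLabel {R : CommRingCat.{u}} {X : Scheme.{u}} (f : X ⟶ Spec R) (x : X) (b : ↥R) :
    Prop :=
  ∃ (n l : ℕ), l ≤ n ∧
    ∃ (U : Scheme.{u}) (gX : U ⟶ X) (x' : ↑U) (gT : U ⟶ stdScheme ↥R n l b),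
      IsEtale gX ∧ IsEtale gT ∧ gX.base x' = x ∧
      gT ≫ stdSpec R n l b = gX ≫ f ∧
      ∀ i : Fin n, (i : ℕ) < l → stdCoord ↥R n l b i ∈ (gT.base x').asIdeal

/-! ### Reduced closed subschemes and strata of fibres -/

/-- A realisation of the closed subset `C ⊆ X` as a reduced closed subscheme of `X`
(such a realisation always exists and is unique up to unique isomorphism). -/
structure ReducedClosedSubscheme (X : Scheme.{u}) (C : Set X) where
  Z : Scheme.{u}
  ι : Z ⟶ X
  isClosedImmersion : IsClosedImmersion ι
  reduced : IsReduced Z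
  range : Set.range ι.base = C

/-- `Sing` is the sequence of iterated non-smooth loci of a scheme `Z` over a field object
`k`: `Sing 0 = Z`, and `Sing (r+1)` is the non-smooth locus over `k` of `Sing r` endowed
with its reduced induced closed subscheme structure. -/
def IsSingSeq {k : CommRingCat.{u}} {Z : Scheme.{u}} (g : Z ⟶ Spec k)
    (Sing : ℕ → Set Z) : Prop :=
  Sing 0 = Set.univ ∧
  ∀ r : ℕ, ∃ W : ReducedClosedSubscheme Z (Sing r),
    Sing (r + 1) = W.ι.base '' {z | ¬ SmoothAtPt (W.ι ≫ g) z}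

/-- `T` is an `r`-stratum of the scheme `Z` over the field object `k`: an irreducible
component of the smooth locus of the `r`-th iterated non-smooth locus of `Z` over `k`. -/
def IsStratum {k : CommRingCat.{u}} {Z : Scheme.{u}} (g : Z ⟶ Spec k) (r : ℕ)
    (T : Set Z) : Prop :=
  ∃ Sing : ℕ → Set Z, IsSingSeq g Sing ∧
    ∃ W : ReducedClosedSubscheme Z (Sing r),
      ∃ T' ∈ irreducibleComponents {z : W.Z // SmoothAtPt (W.ι ≫ g) z},
        T = W.ι.base '' (Subtype.val '' T')

/-! ### Dual graphs, cycles and alignment over a local base -/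

/-- The (1-)stratum `T` of the closed fibre of `f` has label `b` (i.e. some — equivalently,
by constancy of labels, any — point of it has label `b`). -/
def StratumHasLabel {R : CommRingCat.{u}} {X : Scheme.{u}} (f : X ⟶ Spec R)
    (s : ↑(Spec R)) (T : Set (fiberScheme f s)) (b : ↥R) : Prop :=
  ∃ z ∈ T, HasLabel f ((fiberι f s).base z) b

/-- A cycle in the dual graph of the fibre of `f : X ⟶ Spec R` over the point `s`:
a cyclic sequence of pairwise distinct vertices (irreducible components of the fibre)
joined by pairwise distinct edges (1-strata, each contained in exactly the two
neighbouring components). -/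
structure GraphCycle {R : CommRingCat.{u}} {X : Scheme.{u}} (f : X ⟶ Spec R)
    (s : ↑(Spec R)) where
  N : ℕ
  hN : 0 < N
  v : Fin N → Set (fiberScheme f s)
  hv : ∀ i, v i ∈ irreducibleComponents ↑(fiberScheme f s)
  v_inj : Function.Injective v
  T : Fin N → Set (fiberScheme f s)
  hT : ∀ i, IsStratum (fiberRes f s) 1 (T i)
  T_inj : Function.Injective T
  incident : ∀ i : Fin N,
    {c ∈ irreducibleComponents ↑(fiberScheme f s) | T i ⊆ c} =
      {v i, v (⟨((i : ℕ) + 1) % N, Nat.mod_lt _ hN⟩ : Fin N)}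

/-- `f : X ⟶ Spec R` (for `R` local) is aligned at the closed point: for any cycle in the
dual graph of the closed fibre, the labels of any two of its edges admit equal positive
powers (as ideals of `R`). -/
def AlignedOver {R : CommRingCat.{u}} (hR : IsLocalRing ↥R) {X : Scheme.{u}}
    (f : X ⟶ Spec R) : Prop :=
  ∀ (c : GraphCycle f (closedPt R hR)) (i j : Fin c.N) (bi bj : ↥R),
    StratumHasLabel f (closedPt R hR) (c.T i) bi →
    StratumHasLabel f (closedPt R hR) (c.T j) bj →
    ∃ n m : ℕ, 0 < n ∧ 0 < m ∧ Ideal.span {bi} ^ n = Ideal.span {bj} ^ m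

/-- `f : X ⟶ S` is aligned (at every geometric point): the base change of `f` to any
Noetherian strictly henselian local test ring over `S` is aligned at the closed point.
(Taking the test ring to be a strict henselisation of a local ring of `S` recovers the
notion of alignment at a geometric point of `S`.) -/
def IsAligned {X S : Scheme.{u}} (f : X ⟶ S) : Prop :=
  ∀ (A : CommRingCat.{u}), IsNoetherianRing ↥A →
    ∀ (h : StrictlyHenselianLocal ↥A) (g : Spec A ⟶ S),
      AlignedOver h.toIsLocalRing (pullback.snd f g)

/-! ### The specialisation relation on irreducible components of fibres -/

/-- The irreducible component `Z` of the fibre `X_s` specialises (under `sp_{s→η}`) to the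
irreducible component `Y` of `X_η`, i.e. `Z` is contained in the fibre over `s` of the
closure of `Y` in `X`. -/
def spRel {X S : Scheme.{u}} (f : X ⟶ S) (s η : S)
    (Z : Set (fiberScheme f s)) (Y : Set (fiberScheme f η)) : Prop :=
  (fiberι f s).base '' Z ⊆ closure ((fiberι f η).base '' Y)

/-- `C` is a connected component of the subset `A` of a topological space. -/
def IsConnCompOf {α : Type u} [TopologicalSpace α] (A C : Set α) : Prop :=
  ∃ x : ↥A, C = Subtype.val '' connectedComponent x
/-! ### Orders of vanishing, Weil divisors and Cartier divisors -/

/-- `a` has order (length of `A/(a)` as an `A`-module, computed as the Krull dimension of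
the lattice of submodules) equal to `m`. -/
def elemOrd (A : Type u) [CommRing A] (a : A) (m : ℕ) : Prop :=
  Order.krullDim (Submodule A (A ⧸ Ideal.span {a})) = (m : ℕ∞)

/-- The order of vanishing of `a ∈ R` at the point `p` of `Spec R` is `k`. -/
def IsLocOrd {R : Type u} [CommRing R] (a : R) (p : PrimeSpectrum R) (k : ℕ) : Prop :=
  elemOrd (Localization (@Ideal.primeCompl R _ p.asIdeal p.2))
    (algebraMap R (Localization (@Ideal.primeCompl R _ p.asIdeal p.2)) a) k

/-- `z` is a divisorial point of `X`: its local ring has Krull dimension 1, i.e. the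
closure of `z` is a prime divisor on `X`. -/
def IsDivisorialPt (X : Scheme.{u}) (z : X) : Prop :=
  ringKrullDim ↥(X.presheaf.stalk z) = 1

/-- The order of vanishing at `z ∈ V` of the section `h ∈ Γ(X, V)` is `m`. -/
def germOrd {X : Scheme.{u}} (V : X.Opens) (h : Γ(X, V)) (z : X) (hz : z ∈ V)
    (m : ℕ) : Prop :=
  elemOrd ↥(X.presheaf.stalk z) (X.presheaf.germ V z hz h) m

/-- A Weil divisor on `X` is recorded as a coefficient function on points of `X`; only its
values at divisorial points are relevant. `CutsOn D V h₁ h₂` says that on the open set `V`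
the divisor `D` is cut out by the pair of nonzerodivisors `(h₁, h₂)` (i.e. `D` equals
`div h₁ − div h₂` on `V`). -/
def CutsOn {X : Scheme.{u}} (D : X → ℤ) (V : X.Opens) (h₁ h₂ : Γ(X, V)) : Prop :=
  h₁ ∈ nonZeroDivisors Γ(X, V) ∧ h₂ ∈ nonZeroDivisors Γ(X, V) ∧
  ∀ z (hz : z ∈ V), IsDivisorialPt X z →
    ∀ m₁ m₂ : ℕ, germOrd V h₁ z hz m₁ → germOrd V h₂ z hz m₂ →
      D z = (m₁ : ℤ) - (m₂ : ℤ)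

/-- The Weil divisor `D` is a Cartier divisor: it is cut out locally by ratios of
nonzerodivisor sections. -/
def IsCartierDiv {X : Scheme.{u}} (D : X → ℤ) : Prop :=
  ∀ x : X, ∃ V : X.Opens, x ∈ V ∧ ∃ h₁ h₂ : Γ(X, V), CutsOn D V h₁ h₂

/-- `D'` is the pullback along `p : W ⟶ X` of the Cartier divisor `D` on `X`: at every
divisorial point of `W`, the coefficient of `D'` is computed by pulling back local
equations of `D`. -/
def IsDivPullback {W X : Scheme.{u}} (p : W ⟶ X) (D : X → ℤ) (D' : W → ℤ) : Prop :=
  ∀ w : W, IsDivisorialPt W w →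
    ∀ (V : X.Opens) (hw : p.base w ∈ V) (h₁ h₂ : Γ(X, V)), CutsOn D V h₁ h₂ →
      ∀ m₁ m₂ : ℕ, germOrd (p ⁻¹ᵁ V) (p.app V h₁) w hw m₁ →
        germOrd (p ⁻¹ᵁ V) (p.app V h₂) w hw m₂ →
          D' w = (m₁ : ℤ) - (m₂ : ℤ)

/-- Two Weil divisors on `X` are linearly equivalent if their difference is the divisor of
a global ratio of nonzerodivisor sections. -/
def LinEquivDiv {X : Scheme.{u}} (D D' : X → ℤ) : Prop :=
  ∃ h₁ h₂ : Γ(X, ⊤), h₁ ∈ nonZeroDivisors Γ(X, ⊤) ∧ h₂ ∈ nonZeroDivisors Γ(X, ⊤) ∧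
    ∀ z : X, IsDivisorialPt X z →
      ∀ m₁ m₂ : ℕ, germOrd ⊤ h₁ z trivial m₁ → germOrd ⊤ h₂ z trivial m₂ →
        D z - D' z = (m₁ : ℤ) - (m₂ : ℤ)

/-! ### Group schemes over a base (group objects via generalized points) -/

/-- A group scheme over `S`: a scheme `G/S` together with multiplication, unit and
inverse morphisms satisfying the group axioms (expressed on generalized points). -/
structure GroupSchemeOver (S : Scheme.{u}) where
  G : Scheme.{u}
  π : G ⟶ S
  e : S ⟶ G
  e_sec : e ≫ π = 𝟙 S
  mul : pullback π π ⟶ G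
  mul_over : mul ≫ π = pullback.fst π π ≫ π
  inv : G ⟶ G
  inv_over : inv ≫ π = π
  mul_assoc' : ∀ {T : Scheme.{u}} (a b c : T ⟶ G) (hab : a ≫ π = b ≫ π)
    (hbc : b ≫ π = c ≫ π)
    (h₁ : (pullback.lift a b hab ≫ mul) ≫ π = c ≫ π)
    (h₂ : a ≫ π = (pullback.lift b c hbc ≫ mul) ≫ π),
    pullback.lift (pullback.lift a b hab ≫ mul) c h₁ ≫ mul =
      pullback.lift a (pullback.lift b c hbc ≫ mul) h₂ ≫ mul
  one_mul' : ∀ {T : Scheme.{u}} (a : T ⟶ G) (h : (a ≫ π ≫ e) ≫ π = a ≫ π),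
    pullback.lift (a ≫ π ≫ e) a h ≫ mul = a
  mul_one' : ∀ {T : Scheme.{u}} (a : T ⟶ G) (h : a ≫ π = (a ≫ π ≫ e) ≫ π),
    pullback.lift a (a ≫ π ≫ e) h ≫ mul = a
  inv_mul' : ∀ {T : Scheme.{u}} (a : T ⟶ G) (h : (a ≫ inv) ≫ π = a ≫ π),
    pullback.lift (a ≫ inv) a h ≫ mul = a ≫ π ≫ e
/-! ### Line bundles via Čech gluing data, and the relative Picard scheme -/

/-- A line bundle on a scheme `Y`, presented by Čech gluing data: an open cover together
with unit transition functions satisfying the cocycle condition. -/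
structure GluingData (Y : Scheme.{u}) where
  I : Type u
  U : I → Y.Opens
  covers : iSup U = ⊤
  t : ∀ i j : I, Γ(Y, U i ⊓ U j)
  t_isUnit : ∀ i j, IsUnit (t i j)
  cocycle : ∀ i j k : I,
    (Y.presheaf.map (homOfLE (inf_le_left : (U i ⊓ U j) ⊓ U k ≤ U i ⊓ U j)).op) (t i j) *
    (Y.presheaf.map (homOfLE (le_inf (inf_le_left.trans inf_le_right)
      (inf_le_right : (U i ⊓ U j) ⊓ U k ≤ U k))).op) (t j k) =
    (Y.presheaf.map (homOfLE (le_inf (inf_le_left.trans inf_le_left)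
      (inf_le_right : (U i ⊓ U j) ⊓ U k ≤ U k))).op) (t i k)

/-- The trivial line bundle. -/
def trivialGluing (Y : Scheme.{u}) : GluingData Y where
  I := PUnit
  U := fun _ => ⊤
  covers := by simp
  t := fun _ _ => 1
  t_isUnit := fun _ _ => isUnit_one
  cocycle := by intro i j k; simp

/-- `D'` is the pullback of the gluing data `D` along `φ : Z ⟶ Y`. -/
def IsPullbackGluing {Z Y : Scheme.{u}} (φ : Z ⟶ Y) (D : GluingData Y)
    (D' : GluingData Z) : Prop :=
  ∃ eqv : D.I ≃ D'.I,
    (∀ i, D'.U (eqv i) = φ ⁻¹ᵁ D.U i) ∧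
    ∀ (i j : D.I) (hle : D'.U (eqv i) ⊓ D'.U (eqv j) ≤ φ ⁻¹ᵁ (D.U i ⊓ D.U j)),
      D'.t (eqv i) (eqv j) =
        (Z.presheaf.map (homOfLE hle).op) ((φ.app (D.U i ⊓ D.U j)) (D.t i j))

/-- Two gluing data on `Y` present isomorphic line bundles: on a common refinement their
transition functions differ by a coboundary. -/
def GluingIso {Y : Scheme.{u}} (D₁ D₂ : GluingData Y) : Prop :=
  ∃ (K : Type u) (W : K → Y.Opens) (_ : iSup W = ⊤)
    (r₁ : K → D₁.I) (r₂ : K → D₂.I)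
    (_ : ∀ k, W k ≤ D₁.U (r₁ k)) (_ : ∀ k, W k ≤ D₂.U (r₂ k))
    (s : ∀ k, Γ(Y, W k)),
    (∀ k, IsUnit (s k)) ∧
    ∀ (k k' : K) (hle₁ : W k ⊓ W k' ≤ D₁.U (r₁ k) ⊓ D₁.U (r₁ k'))
      (hle₂ : W k ⊓ W k' ≤ D₂.U (r₂ k) ⊓ D₂.U (r₂ k')),
      (Y.presheaf.map (homOfLE hle₁).op) (D₁.t (r₁ k) (r₁ k')) *
        (Y.presheaf.map (homOfLE (inf_le_right : W k ⊓ W k' ≤ W k')).op) (s k') =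
      (Y.presheaf.map (homOfLE (inf_le_left : W k ⊓ W k' ≤ W k)).op) (s k) *
        (Y.presheaf.map (homOfLE hle₂).op) (D₂.t (r₂ k) (r₂ k'))

/-- `D₃` is (isomorphic to) the tensor product of the line bundles presented by `D₁` and
`D₂`: on a common refinement, its transition functions are the products of those of `D₁`
and `D₂`, up to a coboundary. -/
def TensorIso {Y : Scheme.{u}} (D₁ D₂ D₃ : GluingData Y) : Prop :=
  ∃ (K : Type u) (W : K → Y.Opens) (_ : iSup W = ⊤)
    (r₁ : K → D₁.I) (r₂ : K → D₂.I) (r₃ : K → D₃.I)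
    (_ : ∀ k, W k ≤ D₁.U (r₁ k)) (_ : ∀ k, W k ≤ D₂.U (r₂ k))
    (_ : ∀ k, W k ≤ D₃.U (r₃ k)) (s : ∀ k, Γ(Y, W k)),
    (∀ k, IsUnit (s k)) ∧
    ∀ (k k' : K) (hle₁ : W k ⊓ W k' ≤ D₁.U (r₁ k) ⊓ D₁.U (r₁ k'))
      (hle₂ : W k ⊓ W k' ≤ D₂.U (r₂ k) ⊓ D₂.U (r₂ k'))
      (hle₃ : W k ⊓ W k' ≤ D₃.U (r₃ k) ⊓ D₃.U (r₃ k')),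
      (Y.presheaf.map (homOfLE hle₃).op) (D₃.t (r₃ k) (r₃ k')) *
        (Y.presheaf.map (homOfLE (inf_le_right : W k ⊓ W k' ≤ W k')).op) (s k') =
      (Y.presheaf.map (homOfLE (inf_le_left : W k ⊓ W k' ≤ W k)).op) (s k) *
        ((Y.presheaf.map (homOfLE hle₁).op) (D₁.t (r₁ k) (r₁ k')) *
          (Y.presheaf.map (homOfLE hle₂).op) (D₂.t (r₂ k) (r₂ k')))

/-- An fppf cover: faithfully flat and locally of finite presentation. -/
def IsFppfCover {T' T : Scheme.{u}} (c : T' ⟶ T) : Prop :=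
  SchemeFlat c ∧ LocallyOfFinitePresentation c ∧ Function.Surjective c.base

/-- For `g : T ⟶ S` and `c : T' ⟶ T`, the induced morphism `X ×_S T' ⟶ X ×_S T`. -/
def inducedMap {X S T T' : Scheme.{u}} (f : X ⟶ S) (g : T ⟶ S) (c : T' ⟶ T) :
    pullback f (c ≫ g) ⟶ pullback f g :=
  pullback.map f (c ≫ g) f g (𝟙 X) c (𝟙 S) (by simp) (by simp)

/-- Data exhibiting a group scheme `P/S` as (a scheme representing) the relative Picard
functor `Pic_{X/S}`, i.e. the fppf sheafification of `T ↦ Pic(X ×_S T)`: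
a natural assignment `toPic` from line bundles on `X ×_S T` to `T`-points of `P`, which is
compatible with pullback, isomorphism and tensor products, sends the trivial bundle to the
unit section, and is fppf-locally bijective. -/
structure PicardData {X S : Scheme.{u}} (f : X ⟶ S) extends GroupSchemeOver S where
  lfp : LocallyOfFinitePresentation π
  toPic : ∀ {T : Scheme.{u}} (g : T ⟶ S), GluingData (pullback f g) → (T ⟶ G)
  toPic_over : ∀ {T : Scheme.{u}} (g : T ⟶ S) (D : GluingData (pullback f g)),
    toPic g D ≫ π = g
  toPic_trivial : ∀ {T : Scheme.{u}} (g : T ⟶ S),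
    toPic g (trivialGluing _) = g ≫ e
  toPic_pullback : ∀ {T T' : Scheme.{u}} (g : T ⟶ S) (c : T' ⟶ T)
    (D : GluingData (pullback f g)) (D' : GluingData (pullback f (c ≫ g))),
    IsPullbackGluing (inducedMap f g c) D D' → toPic (c ≫ g) D' = c ≫ toPic g D
  toPic_iso : ∀ {T : Scheme.{u}} (g : T ⟶ S) (D₁ D₂ : GluingData (pullback f g)),
    GluingIso D₁ D₂ → toPic g D₁ = toPic g D₂
  toPic_mul : ∀ {T : Scheme.{u}} (g : T ⟶ S) (D₁ D₂ D₃ : GluingData (pullback f g))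
    (_ : TensorIso D₁ D₂ D₃)
    (h : toPic g D₁ ≫ π = toPic g D₂ ≫ π),
    pullback.lift (toPic g D₁) (toPic g D₂) h ≫ mul = toPic g D₃
  locally_surjective : ∀ {T : Scheme.{u}} (g : T ⟶ S) (h : T ⟶ G), h ≫ π = g →
    ∃ (T' : Scheme.{u}) (c : T' ⟶ T), IsFppfCover c ∧
      ∃ D' : GluingData (pullback f (c ≫ g)), toPic (c ≫ g) D' = c ≫ h
  locally_injective : ∀ {T : Scheme.{u}} (g : T ⟶ S)
    (D₁ D₂ : GluingData (pullback f g)), toPic g D₁ = toPic g D₂ →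
    ∃ (T' : Scheme.{u}) (c : T' ⟶ T), IsFppfCover c ∧
      ∃ (D₁' D₂' : GluingData (pullback f (c ≫ g))) (E : GluingData T')
        (E' E₂ : GluingData (pullback f (c ≫ g))),
        IsPullbackGluing (inducedMap f g c) D₁ D₁' ∧
        IsPullbackGluing (inducedMap f g c) D₂ D₂' ∧
        IsPullbackGluing (pullback.snd f (c ≫ g)) E E' ∧
        TensorIso D₁' E' E₂ ∧ GluingIso E₂ D₂'

/-! ### `Pic⁰`, scheme-theoretic closures and Néron models -/

/-- The fibrewise identity component of a group scheme `P/S` over the open set `U ⊆ S`: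
the set of points lying over `U` and belonging to the connected component of the unit
section inside their fibre. -/
def pic0Set {S : Scheme.{u}} (P : GroupSchemeOver S) (U : S.Opens) : Set P.G :=
  {p | P.π.base p ∈ U ∧
    p ∈ connectedComponentIn (P.π.base ⁻¹' {P.π.base p}) (P.e.base (P.π.base p))}

/-- `(Z, ι)` is the scheme-theoretic closure (scheme-theoretic image) of `g : A ⟶ P`:
the smallest closed subscheme of `P` through which `g` factors. -/
structure IsSchClosure {A P : Scheme.{u}} (g : A ⟶ P) (Z : Scheme.{u}) (ι : Z ⟶ P) :
    Prop where
  isClosedImmersion : IsClosedImmersion ι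
  factors : ∃ g' : A ⟶ Z, g' ≫ ι = g
  smallest : ∀ (W : Scheme.{u}) (κ : W ⟶ P), IsClosedImmersion κ →
    (∃ w : A ⟶ W, w ≫ κ = g) → ∃ ρ : Z ⟶ W, ρ ≫ κ = ι

/-- A Néron model over `S` of a smooth "abelian" scheme `A` over the dense open `U ⊆ S`:
a smooth separated scheme `N/S` with an isomorphism `N ×_S U ≅ A` over `U`, satisfying
the Néron mapping property.  (The paper allows `N` to be an algebraic space; algebraic
spaces are not available in Mathlib, so schemes are used.) -/
structure NeronModelData {S : Scheme.{u}} (U : S.Opens) {A : Scheme.{u}}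
    (aU : A ⟶ U.toScheme) where
  N : Scheme.{u}
  ν : N ⟶ S
  smooth : IsSmooth ν
  separated : IsSeparated ν
  isoU : (ν ⁻¹ᵁ U).toScheme ≅ A
  isoU_over : isoU.hom ≫ aU = ν ∣_ U
  mapping : ∀ (T : Scheme.{u}) (t : T ⟶ S), IsSmooth t →
    ∀ (φU : (t ⁻¹ᵁ U).toScheme ⟶ A), φU ≫ aU = t ∣_ U →
      ∃! φ : T ⟶ N, φ ≫ ν = t ∧
        (t ⁻¹ᵁ U).ι ≫ φ = φU ≫ isoU.inv ≫ (ν ⁻¹ᵁ U).ι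

/-! ### Projective morphisms -/

attribute [local instance] MvPolynomial.gradedAlgebra

/-- Projective `n`-space (over `Spec (ULift ℤ)`). -/
def projSpace (n : ℕ) : Scheme.{u} :=
  Proj (MvPolynomial.homogeneousSubmodule (Fin (n + 1)) (ULift.{u} ℤ))

/-- Relative projective `n`-space over `S`. -/
def projSpaceOver (S : Scheme.{u}) (n : ℕ) : Scheme.{u} :=
  pullback (terminal.from (projSpace.{u} n)) (terminal.from S)

/-- A morphism is projective if it factors as a closed immersion into some relative
projective space over the base. -/
def IsProjectiveMorphism {X S : Scheme.{u}} (f : X ⟶ S) : Prop :=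
  ∃ (n : ℕ) (ι : X ⟶ projSpaceOver S n),
    IsClosedImmersion ι ∧ ι ≫ pullback.snd _ _ = f
end NeronSemistable
end

noncomputable section
namespace NeronSemistable

set_option linter.all false
set_option linter.style.haveILetI false

section

open TensorProduct in
/-- The rational point of `Spec (L ⊗ B)` defined by an `L`-valued point of `Spec B`. -/
def ratPt {k B : Type u} [Field k] [CommRing B] [Algebra k B] (L : Type u) [Field L]
    [Algebra k L] (x : B →ₐ[k] L) : PrimeSpectrum (L ⊗[k] B) :=
  PrimeSpectrum.comap (Algebra.TensorProduct.lift (AlgHom.id k L) x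
    (fun _ _ => Commute.all _ _)).toRingHom ⊥

open TensorProduct in
lemma notMem_closure_sum {R : Type u} [CommRing R] {ι : Type} (s : Finset ι) (f c : ι → R)
    (p : PrimeSpectrum R)
    (h : ∀ i ∈ s, p ∉ closure (PrimeSpectrum.basicOpen (f i) : Set (PrimeSpectrum R))) :
    p ∉ closure (PrimeSpectrum.basicOpen (∑ i ∈ s, c i * f i) : Set (PrimeSpectrum R)) := by
  have h1 : (PrimeSpectrum.basicOpen (∑ i ∈ s, c i * f i) : Set (PrimeSpectrum R)) ⊆
      ⋃ i ∈ s, (PrimeSpectrum.basicOpen (f i) : Set (PrimeSpectrum R)) := by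
    intro q hq
    by_contra hcon
    simp only [Set.mem_iUnion, not_exists] at hcon
    apply hq
    refine Ideal.sum_mem _ fun i hi => Ideal.mul_mem_left _ _ ?_
    by_contra h2
    exact hcon i hi h2
  intro hp
  have h2 := closure_mono h1 hp
  rw [Finset.closure_biUnion] at h2
  simp only [Set.mem_iUnion] at h2
  obtain ⟨i, hi, h3⟩ := h2
  exact h i hi h3

lemma exists_field_point {R : Type u} [CommRing R] (p : PrimeSpectrum R) :
    ∃ (K : Type u) (_ : Field K) (g : R →+* K), PrimeSpectrum.comap g ⊥ = p := by
  refine ⟨p.asIdeal.ResidueField, inferInstance, algebraMap R _, ?_⟩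
  apply PrimeSpectrum.ext
  change Ideal.comap _ ⊥ = _
  exact Ideal.ker_algebraMap_residueField _

open TensorProduct in
/-- Key algebraic lemma. -/
lemma exists_generic_point {k B : Type u} [Field k] [CommRing B] [Algebra k B] {n : ℕ}
    (b : Fin n → B) (N : Set (PrimeSpectrum B)) (hN : IsOpen N) (hne : N.Nonempty) :
    ∃ (L : Type u) (_ : Field L) (_ : Algebra k L) (x : B →ₐ[k] L),
      PrimeSpectrum.comap x.toRingHom ⊥ ∈ N ∧
      ∃ Ω : Set (PrimeSpectrum (L ⊗[k] B)), IsOpen Ω ∧ ratPt L x ∈ Ω ∧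
        ∀ c : Fin n → L,
          ratPt L x ∈ closure (PrimeSpectrum.basicOpen (∑ j, c j ⊗ₜ[k] b j) :
            Set (PrimeSpectrum (L ⊗[k] B))) →
          Ω ⊆ closure (PrimeSpectrum.basicOpen (∑ j, c j ⊗ₜ[k] b j) :
            Set (PrimeSpectrum (L ⊗[k] B))) := by
  classical
  let Good : ℕ → Prop := fun r => ∃ (L : Type u) (_ : Field L) (_ : Algebra k L)
    (x : B →ₐ[k] L), PrimeSpectrum.comap x.toRingHom ⊥ ∈ N ∧
      ∃ v : Fin r → Fin n → L, LinearIndependent L v ∧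
        ∀ i, ratPt L x ∉ closure (PrimeSpectrum.basicOpen (∑ j, v i j ⊗ₜ[k] b j) :
            Set (PrimeSpectrum (L ⊗[k] B)))
  have h0 : Good 0 := by
    obtain ⟨q, hq⟩ := hne
    obtain ⟨K, _, g, hg⟩ := exists_field_point q
    letI : Algebra k K := (g.comp (algebraMap k B)).toAlgebra
    refine ⟨K, inferInstance, inferInstance,
      { g with commutes' := fun _ => rfl }, ?_, Fin.elim0, linearIndependent_empty_type,
        fun i => i.elim0⟩
    subst hg
    exact hq
  have hmax : ∃ r, Good r ∧ ¬ Good (r + 1) := by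
    by_contra! hcon
    have hall : ∀ r, Good r := fun r => Nat.rec h0 (fun r ih => hcon r ih) r
    obtain ⟨L, _, _, x, -, v, hv, -⟩ := hall (n + 1)
    have := hv.fintype_card_le_finrank
    simp at this
  obtain ⟨r, ⟨L, _, _, x, hx, v, hv, hvx⟩, hr⟩ := hmax
  refine ⟨L, inferInstance, inferInstance, x, hx, ?_⟩
  let Ω : Set (PrimeSpectrum (L ⊗[k] B)) :=
    (PrimeSpectrum.comap (Algebra.TensorProduct.includeRight : B →ₐ[k] L ⊗[k] B).toRingHom) ⁻¹' N ∩
    ⋂ i, (closure (PrimeSpectrum.basicOpen (∑ j, v i j ⊗ₜ[k] b j) :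
            Set (PrimeSpectrum (L ⊗[k] B))))ᶜ
  refine ⟨Ω, ?_, ?_, ?_⟩
  · refine (hN.preimage (PrimeSpectrum.continuous_comap _)).inter ?_
    exact isOpen_iInter_of_finite fun i => isClosed_closure.isOpen_compl
  · refine ⟨?_, ?_⟩
    · change PrimeSpectrum.comap _ _ ∈ N
      convert hx using 1
      rw [ratPt, ← PrimeSpectrum.comap_comp_apply]
      congr 1
      congr 1
      ext z
      simp
    · simpa using hvx
  · intro c hc x' hx'
    by_contra hcx'
    apply hr
    have hspan : c ∉ Submodule.span L (Set.range v) := by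
      intro hmem
      obtain ⟨a, ha⟩ := (Submodule.mem_span_range_iff_exists_fun L).1 hmem
      refine notMem_closure_sum Finset.univ (fun i => ∑ j, v i j ⊗ₜ[k] b j)
        (fun i => a i ⊗ₜ[k] (1 : B)) (ratPt L x) (fun i _ => hvx i) ?_
      have hkey : ∑ i, a i ⊗ₜ[k] (1 : B) * ∑ j, v i j ⊗ₜ[k] b j = ∑ j, c j ⊗ₜ[k] b j := ?_
      · rw [hkey]; exact hc
      simp only [Finset.mul_sum, Algebra.TensorProduct.tmul_mul_tmul, one_mul]
      rw [Finset.sum_comm]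
      refine Finset.sum_congr rfl fun j _ => ?_
      rw [← TensorProduct.sum_tmul, ← ha]
      simp
    obtain ⟨L', _, g, hg⟩ := exists_field_point x'
    letI : Algebra L L' := (g.comp
      (Algebra.TensorProduct.includeLeft : L →ₐ[k] L ⊗[k] B).toRingHom).toAlgebra
    let φ : L ⊗[k] B →ₐ[L] L' := { g with commutes' := fun _ => rfl }
    letI : Algebra k L' := ((algebraMap L L').comp (algebraMap k L)).toAlgebra
    haveI : IsScalarTower k L L' := IsScalarTower.of_algebraMap_eq fun _ => rfl
    let y : B →ₐ[k] L' := (φ.restrictScalars k).comp Algebra.TensorProduct.includeRight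
    let ψ : L ⊗[k] B →ₐ[k] L' ⊗[k] B :=
      Algebra.TensorProduct.map (IsScalarTower.toAlgHom k L L') (AlgHom.id k B)
    have hψ : PrimeSpectrum.comap ψ.toRingHom (ratPt L' y) = x' := by
      rw [ratPt, ← PrimeSpectrum.comap_comp_apply]
      have : (Algebra.TensorProduct.lift (AlgHom.id k L') y
          (fun _ _ => Commute.all _ _)).toRingHom.comp ψ.toRingHom = φ.toRingHom := by
        have h3 : (Algebra.TensorProduct.lift (AlgHom.id k L') y
          (fun _ _ => Commute.all _ _)).comp ψ = φ.restrictScalars k := by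
          apply Algebra.TensorProduct.ext
          · ext l
            simpa [ψ] using (φ.commutes l).symm
          · ext z
            simp [ψ, y]
        exact congrArg AlgHom.toRingHom h3
      rw [this]
      exact hg
    have hpull : ∀ w : Fin n → L,
        x' ∉ closure (PrimeSpectrum.basicOpen (∑ j, w j ⊗ₜ[k] b j) :
            Set (PrimeSpectrum (L ⊗[k] B))) →
        ratPt L' y ∉ closure (PrimeSpectrum.basicOpen
            (∑ j, (algebraMap L L' (w j)) ⊗ₜ[k] b j) : Set (PrimeSpectrum (L' ⊗[k] B))) := by
      intro w hw hcl
      apply hw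
      rw [← hψ]
      have := (PrimeSpectrum.continuous_comap ψ.toRingHom).closure_preimage_subset
        (PrimeSpectrum.basicOpen (∑ j, w j ⊗ₜ[k] b j) : Set (PrimeSpectrum (L ⊗[k] B)))
      apply this
      convert hcl using 2
      ext q
      simp [ψ, PrimeSpectrum.mem_basicOpen]
    refine ⟨L', inferInstance, inferInstance, y, ?_, 
      fun i j => algebraMap L L' (Fin.cons (α := fun _ => Fin n → L) c v i j), ?_, ?_⟩
    · have h4 := hx'.1
      change PrimeSpectrum.comap _ _ ∈ N at h4
      convert h4 using 1
      have h5 := congrArg (PrimeSpectrum.comap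
        (Algebra.TensorProduct.includeRight : B →ₐ[k] L ⊗[k] B).toRingHom) hg
      rw [← PrimeSpectrum.comap_comp_apply] at h5
      exact h5
    · exact (linearIndependent_algebraMap_comp_iff (S := L')).2 (linearIndependent_finCons.2 ⟨hv, hspan⟩)
    · intro i
      refine Fin.cases ?_ (fun i => ?_) i
      · exact hpull c hcx'
      · refine hpull (v i) ?_
        have := hx'.2
        simp only [Set.mem_iInter] at this
        exact this i

end

section

attribute [local simp] pullback.lift_fst pullback.lift_snd pullback.lift_fst_assoc pullback.lift_snd_assoc

namespace GroupSchemeOver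

variable {S : Scheme.{u}} (G : GroupSchemeOver S)

/-- Product of two generalized points. -/
def m {T : Scheme.{u}} (a b : T ⟶ G.G) (h : a ≫ G.π = b ≫ G.π) : T ⟶ G.G :=
  pullback.lift a b h ≫ G.mul

lemma m_over {T : Scheme.{u}} (a b : T ⟶ G.G) (h : a ≫ G.π = b ≫ G.π) :
    G.m a b h ≫ G.π = a ≫ G.π := by
  rw [m, Category.assoc, G.mul_over, pullback.lift_fst_assoc]

lemma m_over' {T : Scheme.{u}} (a b : T ⟶ G.G) (h : a ≫ G.π = b ≫ G.π) :
    G.m a b h ≫ G.π = b ≫ G.π := by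
  rw [m_over, h]

lemma comp_m {T T' : Scheme.{u}} (f : T' ⟶ T) (a b : T ⟶ G.G) (h : a ≫ G.π = b ≫ G.π)
    (h' : (f ≫ a) ≫ G.π = (f ≫ b) ≫ G.π) :
    f ≫ G.m a b h = G.m (f ≫ a) (f ≫ b) h' := by
  rw [m, m, ← Category.assoc]
  congr 1
  apply pullback.hom_ext <;> simp

lemma m_congr {T : Scheme.{u}} {a a' b b' : T ⟶ G.G} (ha : a = a') (hb : b = b')
    (h : a ≫ G.π = b ≫ G.π) (h' : a' ≫ G.π = b' ≫ G.π) :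
    G.m a b h = G.m a' b' h' := by
  subst ha hb; rfl

lemma m_assoc {T : Scheme.{u}} (a b c : T ⟶ G.G) (hab : a ≫ G.π = b ≫ G.π)
    (hbc : b ≫ G.π = c ≫ G.π) :
    G.m (G.m a b hab) c (by rw [m_over, hab, hbc]) =
      G.m a (G.m b c hbc) (by rw [m_over, hab]) :=
  G.mul_assoc' a b c hab hbc _ _

lemma unit_over {T : Scheme.{u}} (t : T ⟶ S) : (t ≫ G.e) ≫ G.π = t := by
  rw [Category.assoc, G.e_sec, Category.comp_id]

lemma one_m {T : Scheme.{u}} (a : T ⟶ G.G) (t : T ⟶ S) (h : (t ≫ G.e) ≫ G.π = a ≫ G.π) :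
    G.m (t ≫ G.e) a h = a := by
  have ht : t = a ≫ G.π := by rw [← h, unit_over]
  subst ht
  refine (G.m_congr ?_ rfl _ ?_).trans (G.one_mul' a (by simp [G.e_sec]))
  · simp
  · simp [G.e_sec]

lemma m_one {T : Scheme.{u}} (a : T ⟶ G.G) (t : T ⟶ S) (h : a ≫ G.π = (t ≫ G.e) ≫ G.π) :
    G.m a (t ≫ G.e) h = a := by
  have ht : t = a ≫ G.π := by rw [h, unit_over]
  subst ht
  refine (G.m_congr rfl ?_ _ ?_).trans (G.mul_one' a (by simp [G.e_sec]))
  · simp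
  · simp [G.e_sec]

lemma inv_over' {T : Scheme.{u}} (a : T ⟶ G.G) : (a ≫ G.inv) ≫ G.π = a ≫ G.π := by
  rw [Category.assoc, G.inv_over]

lemma inv_m {T : Scheme.{u}} (a : T ⟶ G.G) (h : (a ≫ G.inv) ≫ G.π = a ≫ G.π) :
    G.m (a ≫ G.inv) a h = (a ≫ G.π) ≫ G.e := by
  rw [Category.assoc]; exact G.inv_mul' a h

lemma m_inv {T : Scheme.{u}} (a : T ⟶ G.G) (h : a ≫ G.π = (a ≫ G.inv) ≫ G.π) :
    G.m a (a ≫ G.inv) h = (a ≫ G.π) ≫ G.e := by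
  -- with `b = a⁻¹`, `c = b⁻¹`: `a b = c b a b = c b = e`
  set b := a ≫ G.inv with hb
  set c := b ≫ G.inv with hc
  have hcb : c ≫ G.π = b ≫ G.π := inv_over' G b
  have hba : b ≫ G.π = a ≫ G.π := inv_over' G a
  have h1 : G.m c b hcb = (b ≫ G.π) ≫ G.e := inv_m G b hcb
  have h2 : G.m b a hba = (a ≫ G.π) ≫ G.e := inv_m G a hba
  have h3 : G.m b (G.m a b h) (by rw [m_over, hba]) = b := by
    rw [← m_assoc G b a b hba h]
    rw [m_congr G h2 rfl _ (by rw [unit_over, h]), one_m]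
  have h4 : G.m c (G.m b (G.m a b h) (by rw [m_over, hba])) (by rw [m_over, hcb]) =
      (b ≫ G.π) ≫ G.e := by
    rw [m_congr G rfl h3 _ hcb, h1]
  rw [← m_assoc G c b (G.m a b h) hcb (by rw [m_over, hba]),
    m_congr G h1 rfl _ (by rw [unit_over, m_over, hba]), one_m] at h4
  rw [h4, hba]

/-- Right translation by a `T`-valued point. -/
def mulR {T : Scheme.{u}} (t : T ⟶ S) (y : T ⟶ G.G) (h : y ≫ G.π = t) :
    pullback G.π t ⟶ G.G :=
  G.m (pullback.fst G.π t) (pullback.snd G.π t ≫ y)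
    (by rw [Category.assoc, h, pullback.condition])

lemma mulR_over {T : Scheme.{u}} (t : T ⟶ S) (y : T ⟶ G.G) (h : y ≫ G.π = t) :
    G.mulR t y h ≫ G.π = pullback.snd G.π t ≫ t := by
  rw [mulR, m_over, pullback.condition]

lemma lift_mulR {T T' : Scheme.{u}} (t : T ⟶ S) (y : T ⟶ G.G) (h : y ≫ G.π = t)
    (a : T' ⟶ G.G) (b : T' ⟶ T) (hab : a ≫ G.π = b ≫ t) :
    pullback.lift a b hab ≫ G.mulR t y h =
      G.m a (b ≫ y) (by rw [Category.assoc, h, hab]) := by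
  rw [mulR, comp_m _ _ _ _ _ (by simp [h, hab])]
  exact m_congr _ (by simp) (by simp) _ _

/-- Right translation as an automorphism of `G_T`. -/
def transR {T : Scheme.{u}} (t : T ⟶ S) (y : T ⟶ G.G) (h : y ≫ G.π = t) :
    pullback G.π t ⟶ pullback G.π t :=
  pullback.lift (G.mulR t y h) (pullback.snd _ _) (G.mulR_over t y h)

lemma transR_comp {T : Scheme.{u}} (t : T ⟶ S) (y y' : T ⟶ G.G) (h : y ≫ G.π = t)
    (h' : y' ≫ G.π = t) (hyy : G.m y y' (h.trans h'.symm) = t ≫ G.e) :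
    G.transR t y h ≫ G.transR t y' h' = 𝟙 _ := by
  apply pullback.hom_ext
  · rw [transR, transR, Category.assoc, pullback.lift_fst, lift_mulR, Category.id_comp]
    have e1 := m_assoc G (pullback.fst G.π t) (pullback.snd G.π t ≫ y) (pullback.snd G.π t ≫ y')
      (by rw [Category.assoc, h, pullback.condition]) (by simp [h, h'])
    refine e1.trans ?_
    rw [m_congr G rfl (show _ = (pullback.snd G.π t ≫ t) ≫ G.e by
        rw [← comp_m G (pullback.snd G.π t) y y' (h.trans h'.symm), hyy, Category.assoc]) _
      (by rw [unit_over, pullback.condition]), m_one]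
  · simp [transR]

instance {T : Scheme.{u}} (t : T ⟶ S) (y : T ⟶ G.G) (h : y ≫ G.π = t) :
    IsIso (G.transR t y h) := by
  have h' : (y ≫ G.inv) ≫ G.π = t := by rw [inv_over', h]
  refine ⟨G.transR t (y ≫ G.inv) h', transR_comp _ _ _ _ _ _ ?_, transR_comp _ _ _ _ _ _ ?_⟩
  · rw [m_inv, h]
  · rw [inv_m, h]

lemma transR_fst {T : Scheme.{u}} (t : T ⟶ S) (y : T ⟶ G.G) (h : y ≫ G.π = t) :
    G.transR t y h ≫ pullback.fst _ _ = G.mulR t y h := by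
  simp [transR]

/-- Base change of a group scheme. -/
def baseChange {T : Scheme.{u}} (t : T ⟶ S) : GroupSchemeOver T where
  G := pullback G.π t
  π := pullback.snd _ _
  e := pullback.lift (t ≫ G.e) (𝟙 T) (by rw [unit_over, Category.id_comp])
  e_sec := by simp
  mul := pullback.lift
    (G.m (pullback.fst (pullback.snd G.π t) (pullback.snd G.π t) ≫ pullback.fst G.π t)
      (pullback.snd (pullback.snd G.π t) (pullback.snd G.π t) ≫ pullback.fst G.π t)
      (by rw [Category.assoc, Category.assoc, pullback.condition, pullback.condition_assoc]))
    (pullback.fst _ _ ≫ pullback.snd _ _)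
    (by rw [m_over, Category.assoc, Category.assoc, pullback.condition])
  mul_over := by simp
  inv := pullback.lift (pullback.fst _ _ ≫ G.inv) (pullback.snd _ _)
    (by rw [inv_over', pullback.condition])
  inv_over := by simp
  mul_assoc' := by
    intro T' a b c hab hbc h₁ h₂
    have q (a b : T' ⟶ pullback G.π t) (hab : a ≫ pullback.snd G.π t = b ≫ pullback.snd G.π t) :
      (a ≫ pullback.fst _ _) ≫ G.π = (b ≫ pullback.fst _ _) ≫ G.π := by
      rw [Category.assoc, Category.assoc, pullback.condition, reassoc_of% hab]
    have hm (a b : T' ⟶ pullback G.π t) (hab : a ≫ pullback.snd G.π t = b ≫ pullback.snd G.π t) :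
        pullback.lift a b hab ≫ G.m (pullback.fst (pullback.snd G.π t) (pullback.snd G.π t) ≫
            pullback.fst G.π t)
          (pullback.snd (pullback.snd G.π t) (pullback.snd G.π t) ≫ pullback.fst G.π t)
          (by rw [Category.assoc, Category.assoc, pullback.condition, pullback.condition_assoc]) =
        G.m (a ≫ pullback.fst _ _) (b ≫ pullback.fst _ _) (q a b hab) := by
      rw [comp_m _ _ _ _ _ (by simpa using q a b hab)]
      exact m_congr _ (by simp) (by simp) _ _
    apply pullback.hom_ext
    · simp only [Category.assoc, pullback.lift_fst]
      rw [hm, hm]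
      refine (m_congr G ?_ rfl _ ?_).trans
        ((m_assoc G (a ≫ pullback.fst _ _) (b ≫ pullback.fst _ _)
        (c ≫ pullback.fst _ _) (q _ _ hab) (q _ _ hbc)).trans (m_congr G rfl ?_ _ _))
      · rw [Category.assoc, pullback.lift_fst, hm]
      · rw [m_over, q _ _ hab, q _ _ hbc]
      · rw [Category.assoc, pullback.lift_fst, hm]
    · simp
  one_mul' := by
    intro T' a h
    apply pullback.hom_ext
    · simp only [Category.assoc, pullback.lift_fst]
      rw [comp_m _ _ _ _ _ (by simp [G.e_sec, pullback.condition])]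
      refine (m_congr G (a' := (a ≫ pullback.snd _ _ ≫ t) ≫ G.e) (b' := a ≫ pullback.fst _ _)
        (by simp) (by simp) _ (by simp [G.e_sec, pullback.condition])).trans (one_m _ _ _ _)
    · simp
  mul_one' := by
    intro T' a h
    apply pullback.hom_ext
    · simp only [Category.assoc, pullback.lift_fst]
      rw [comp_m _ _ _ _ _ (by simp [G.e_sec, pullback.condition])]
      refine (m_congr G (b' := (a ≫ pullback.snd _ _ ≫ t) ≫ G.e) (a' := a ≫ pullback.fst _ _)
        (by simp) (by simp) _ (by simp [G.e_sec, pullback.condition])).trans (m_one _ _ _ _)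
    · simp
  inv_mul' := by
    intro T' a h
    apply pullback.hom_ext
    · simp only [Category.assoc, pullback.lift_fst]
      rw [comp_m _ _ _ _ _ (by simp [G.inv_over])]
      refine (m_congr G (a' := (a ≫ pullback.fst _ _) ≫ G.inv) (b' := a ≫ pullback.fst _ _)
        (by simp) (by simp) _ (by simp [G.inv_over])).trans ?_
      rw [inv_m]
      simp [pullback.condition_assoc]
    · simp

end GroupSchemeOver

end

section

lemma local_basicOpen {X : Scheme.{u}} {A R : CommRingCat.{u}} (j : Spec A ⟶ X)
    [IsOpenImmersion j] (μ : Spec R ⟶ X) (p : Spec R) (hp : μ p ∈ Set.range j) (f : A) :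
    ∃ h F : R, p ∈ PrimeSpectrum.basicOpen h ∧
      ∀ q : Spec R, q ∈ PrimeSpectrum.basicOpen h →
        (μ q ∈ (j '' (PrimeSpectrum.basicOpen f : Set (PrimeSpectrum A))) ↔
          q ∈ PrimeSpectrum.basicOpen F) := by
  have hV : IsOpen (μ ⁻¹' (Set.range j)) := j.isOpenEmbedding.isOpen_range.preimage μ.continuous
  obtain ⟨-, ⟨h, rfl⟩, hph, hhV⟩ :=
    PrimeSpectrum.isTopologicalBasis_basic_opens.exists_subset_of_mem_open hp hV
  let Rh := CommRingCat.of (Localization.Away h)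
  let loc : R ⟶ Rh := CommRingCat.ofHom (algebraMap R (Localization.Away h))
  have hrange : Set.range (Spec.map loc) = (PrimeSpectrum.basicOpen h : Set (PrimeSpectrum R)) :=
    PrimeSpectrum.localization_away_comap_range (Localization.Away h) h
  have hsub : Set.range (Spec.map loc ≫ μ) ⊆ Set.range j := by
    rintro - ⟨q, rfl⟩
    rw [Scheme.Hom.comp_apply]
    exact hhV (hrange.subset ⟨q, rfl⟩)
  obtain ⟨φ, hφ⟩ := Spec.map_surjective (IsOpenImmersion.lift j (Spec.map loc ≫ μ) hsub)
  have hfac : Spec.map φ ≫ j = Spec.map loc ≫ μ := by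
    rw [hφ, IsOpenImmersion.lift_fac]
  obtain ⟨⟨F, ⟨s, hs⟩⟩, hF⟩ := IsLocalization.surj (M := Submonoid.powers h) (φ.hom f)
  refine ⟨h, F, hph, fun q hq => ?_⟩
  obtain ⟨q', rfl⟩ : q ∈ Set.range (Spec.map loc) := hrange ▸ hq
  have h1 : μ (Spec.map loc q') = j (Spec.map φ q') := by
    rw [← Scheme.Hom.comp_apply, ← Scheme.Hom.comp_apply, hfac]
  rw [h1]
  have h2 : j (Spec.map φ q') ∈ (j '' (PrimeSpectrum.basicOpen f : Set (PrimeSpectrum A))) ↔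
      Spec.map φ q' ∈ (PrimeSpectrum.basicOpen f : Set (PrimeSpectrum A)) :=
    j.isOpenEmbedding.injective.mem_set_image
  rw [h2]
  change φ.hom f ∉ q'.asIdeal ↔ algebraMap R (Localization.Away h) F ∉ q'.asIdeal
  rw [← hF]
  have hu : IsUnit (algebraMap R (Localization.Away h) s) :=
    IsLocalization.map_units (M := Submonoid.powers h) _ ⟨s, hs⟩
  have h3 := Ideal.mul_unit_mem_iff_mem q'.asIdeal hu (x := φ.hom f)
  exact not_congr h3.symm

end

section

open TensorProduct in
/-- Right translation by an `L`-point on an affine chart is an open map. -/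
lemma chart_mulR_isOpenMap {k : Type u} [Field k] (G : GroupSchemeOver (Spec (.of k)))
    {B : Type u} [CommRing B] [Algebra k B] (j' : Spec (.of B) ⟶ G.G) [IsOpenImmersion j']
    (hj' : j' ≫ G.π = Spec.map (CommRingCat.ofHom (algebraMap k B)))
    (L : Type u) [Field L] [Algebra k L] (yy : Spec (.of L) ⟶ G.G)
    (hyy : yy ≫ G.π = Spec.map (CommRingCat.ofHom (algebraMap k L)))
    (h : (Spec.map (CommRingCat.ofHom (S := L ⊗[k] B)
      Algebra.TensorProduct.includeRight.toRingHom) ≫ j') ≫ G.π =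
      (Spec.map (CommRingCat.ofHom (S := L ⊗[k] B)
        Algebra.TensorProduct.includeLeftRingHom) ≫ yy) ≫ G.π) :
    IsOpenMap (G.m (Spec.map (CommRingCat.ofHom (S := L ⊗[k] B)
      Algebra.TensorProduct.includeRight.toRingHom) ≫ j') (Spec.map (CommRingCat.ofHom (S := L ⊗[k] B)
        Algebra.TensorProduct.includeLeftRingHom) ≫ yy) h) := by
  set t := Spec.map (CommRingCat.ofHom (algebraMap k L)) with ht
  set r := Spec.map (CommRingCat.ofHom (S := L ⊗[k] B)
      Algebra.TensorProduct.includeRight.toRingHom) with hr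
  set l := Spec.map (CommRingCat.ofHom (S := L ⊗[k] B)
        Algebra.TensorProduct.includeLeftRingHom) with hl
  have hab : (r ≫ j') ≫ G.π = l ≫ t := by
    rw [h, Category.assoc, hyy]
  rw [← G.lift_mulR t yy hyy (r ≫ j') l hab, ← G.transR_fst]
  have hp : IsPullback r l (j' ≫ G.π) t := by
    rw [hj']
    exact (isPullback_SpecMap_of_isPushout _ _ _ _
      (CommRingCat.isPushout_tensorProduct k L B)).flip
  have hp2 : IsPullback r (pullback.lift (r ≫ j') l hab) j' (pullback.fst G.π t) := by
    refine (IsPullback.of_right ?_ ?_ (IsPullback.of_hasPullback G.π t).flip).flip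
    · simpa [pullback.lift_snd] using hp.flip
    · simp [pullback.lift_fst]
  have : IsOpenImmersion (pullback.lift (r ≫ j') l hab) :=
    MorphismProperty.of_isPullback (P := @IsOpenImmersion) hp2 inferInstance
  have h1 : UniversallyOpen (pullback.fst G.π t) := inferInstance
  exact Scheme.Hom.isOpenMap (pullback.lift (r ≫ j') l hab ≫ G.transR t yy hyy ≫
    pullback.fst G.π t)

open TensorProduct in
lemma prop1_aux {k : Type u} [Field k] (G : GroupSchemeOver (Spec (.of k)))
    {A B : Type u} [CommRing A] [CommRing B] [Algebra k A] [Algebra k B]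
    (j : Spec (.of A) ⟶ G.G) [IsOpenImmersion j]
    (j' : Spec (.of B) ⟶ G.G) [IsOpenImmersion j']
    (hj : j ≫ G.π = Spec.map (CommRingCat.ofHom (algebraMap k A)))
    (hj' : j' ≫ G.π = Spec.map (CommRingCat.ofHom (algebraMap k B)))
    (ι : A →ₐ[k] B) (hι : Spec.map (CommRingCat.ofHom ι.toRingHom) ≫ j = j' ≫ G.inv)
    (pt : Spec (.of k)) (he : G.e pt ∈ Set.range j) (he' : G.e pt ∈ Set.range j') (f : A)
    (hcl : G.e pt ∈ closure (j '' (PrimeSpectrum.basicOpen f : Set (PrimeSpectrum A)))) :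
    closure (j '' (PrimeSpectrum.basicOpen f : Set (PrimeSpectrum A))) ∈ nhds (G.e pt) := by
  classical
  set D := j '' (PrimeSpectrum.basicOpen f : Set (PrimeSpectrum A)) with hD
  let bL : CommRingCat.of B ⟶ CommRingCat.of (B ⊗[k] A) :=
    CommRingCat.ofHom (S := B ⊗[k] A) Algebra.TensorProduct.includeLeftRingHom
  let aR : CommRingCat.of A ⟶ CommRingCat.of (B ⊗[k] A) :=
    CommRingCat.ofHom (S := B ⊗[k] A) Algebra.TensorProduct.includeRight.toRingHom
  have hw : (Spec.map bL ≫ j') ≫ G.π = (Spec.map aR ≫ j) ≫ G.π := by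
    rw [Category.assoc, Category.assoc, hj, hj', ← Spec.map_comp, ← Spec.map_comp]
    congr 1
    exact (CommRingCat.isPushout_tensorProduct k B A).w
  let μ : Spec (.of (B ⊗[k] A)) ⟶ G.G := G.m (Spec.map bL ≫ j') (Spec.map aR ≫ j) hw
  let δ : CommRingCat.of (B ⊗[k] A) ⟶ CommRingCat.of B :=
    CommRingCat.ofHom (Algebra.TensorProduct.lift (AlgHom.id k B) ι
      (fun _ _ => Commute.all _ _)).toRingHom
  have hδL : bL ≫ δ = 𝟙 _ := by
    ext z; simp [bL, δ]
  have hδR : aR ≫ δ = CommRingCat.ofHom ι.toRingHom := by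
    ext z; simp [aR, δ]
  have hδμ : Spec.map δ ≫ μ = (j' ≫ G.π) ≫ G.e := by
    have e1 : Spec.map δ ≫ Spec.map bL ≫ j' = j' := by
      rw [← Spec.map_comp_assoc, hδL, Spec.map_id, Category.id_comp]
    have e2 : Spec.map δ ≫ Spec.map aR ≫ j = j' ≫ G.inv := by
      rw [← Spec.map_comp_assoc, hδR, hι]
    have e3 : j' ≫ G.π = (j' ≫ G.inv) ≫ G.π := (G.inv_over' _).symm
    rw [← G.m_inv j' e3, G.comp_m _ _ _ _ (by rw [e1, e2, e3])]
    exact G.m_congr e1 e2 _ _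
  have hsub : ∀ z : Spec (.of k), z = pt := fun z => by
    change (z : PrimeSpectrum k) = pt
    exact Subsingleton.elim _ _
  have hδμ' : ∀ q : Spec (.of B), μ (Spec.map δ q) = G.e pt := by
    intro q
    rw [← Scheme.Hom.comp_apply, hδμ, Scheme.Hom.comp_apply]
    exact congrArg _ (hsub _)
  obtain ⟨eB, heB⟩ := he'
  obtain ⟨h, F, hp0, hF⟩ := local_basicOpen j μ (Spec.map δ eB) (by rw [hδμ']; exact he) f
  obtain ⟨n, b, a, hFsum⟩ := TensorProduct.exists_sum_tmul_eq (R := k) (M := B) (N := A) F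
  let N : Set (PrimeSpectrum B) :=
    (Spec.map δ) ⁻¹' (PrimeSpectrum.basicOpen h : Set (PrimeSpectrum (B ⊗[k] A)))
  obtain ⟨L, _, _, x, hxN, Ω, hΩo, hxΩ, hΩ⟩ := exists_generic_point (k := k) b N
    ((PrimeSpectrum.basicOpen h).isOpen.preimage (Spec.map δ).continuous) ⟨eB, hp0⟩
  let y : A →ₐ[k] L := x.comp ι
  let τ : CommRingCat.of (B ⊗[k] A) ⟶ CommRingCat.of (L ⊗[k] B) :=
    CommRingCat.ofHom (Algebra.TensorProduct.lift
      (Algebra.TensorProduct.includeRight : B →ₐ[k] L ⊗[k] B)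
      ((Algebra.TensorProduct.includeLeft : L →ₐ[k] L ⊗[k] B).comp y)
      (fun _ _ => Commute.all _ _)).toRingHom
  let yy : Spec (.of L) ⟶ G.G := Spec.map (CommRingCat.ofHom y.toRingHom) ≫ j
  have hyy : yy ≫ G.π = Spec.map (CommRingCat.ofHom (algebraMap k L)) := by
    rw [Category.assoc, hj, ← Spec.map_comp]
    congr 1
    ext z
    simp
  let ρ := Spec.map τ ≫ μ
  have hρ : IsOpenMap ρ := by
    have e1 : Spec.map τ ≫ Spec.map bL ≫ j' = Spec.map (CommRingCat.ofHom (S := L ⊗[k] B)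
      Algebra.TensorProduct.includeRight.toRingHom) ≫ j' := by
      rw [← Spec.map_comp_assoc]
      congr 2
      ext z; simp [bL, τ]
    have e2 : Spec.map τ ≫ Spec.map aR ≫ j = Spec.map (CommRingCat.ofHom (S := L ⊗[k] B)
        Algebra.TensorProduct.includeLeftRingHom) ≫ yy := by
      rw [← Spec.map_comp_assoc, ← Spec.map_comp_assoc]
      congr 2
      ext z; simp [aR, τ]
    have e3 : (Spec.map τ ≫ Spec.map bL ≫ j') ≫ G.π = (Spec.map τ ≫ Spec.map aR ≫ j) ≫ G.π := by
      rw [Category.assoc (Spec.map τ), Category.assoc (Spec.map τ), hw]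
    have e4 := chart_mulR_isOpenMap G j' hj' L yy hyy (by rw [← e1, ← e2, e3])
    have e5 : ρ = _ := (G.comp_m (Spec.map τ) _ _ hw e3).trans (G.m_congr e1 e2 _
      (by rw [← e1, ← e2, e3]))
    rw [e5]
    exact e4
  have hτx : Spec.map τ (ratPt L x) =
      Spec.map δ (PrimeSpectrum.comap x.toRingHom ⊥ : PrimeSpectrum B) := by
    change PrimeSpectrum.comap τ.hom (PrimeSpectrum.comap _ _) =
      PrimeSpectrum.comap δ.hom (PrimeSpectrum.comap _ _)
    rw [← PrimeSpectrum.comap_comp_apply, ← PrimeSpectrum.comap_comp_apply]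
    congr 1
    have : ((Algebra.TensorProduct.lift (AlgHom.id k L) x (fun _ _ => Commute.all _ _)).comp
      (Algebra.TensorProduct.lift
      (Algebra.TensorProduct.includeRight : B →ₐ[k] L ⊗[k] B)
      ((Algebra.TensorProduct.includeLeft : L →ₐ[k] L ⊗[k] B).comp y)
      (fun _ _ => Commute.all _ _))) =
      x.comp (Algebra.TensorProduct.lift (AlgHom.id k B) ι (fun _ _ => Commute.all _ _)) := by
      apply Algebra.TensorProduct.ext
      · ext z; simp
      · ext z; simp [y]
    exact congrArg AlgHom.toRingHom this
  have hρx : ρ (ratPt L x) = G.e pt := by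
    have h2 : ρ (ratPt L x) = μ (Spec.map τ (ratPt L x)) := Scheme.Hom.comp_apply _ _ _
    rw [h2, hτx]
    exact hδμ' _
  let H : Set (PrimeSpectrum (L ⊗[k] B)) :=
    (Spec.map τ) ⁻¹' (PrimeSpectrum.basicOpen h : Set (PrimeSpectrum (B ⊗[k] A)))
  have hH : IsOpen H := (PrimeSpectrum.basicOpen h).isOpen.preimage (Spec.map τ).continuous
  have hxH : ratPt L x ∈ H := by
    change Spec.map τ (ratPt L x) ∈ (PrimeSpectrum.basicOpen h : Set (PrimeSpectrum (B ⊗[k] A)))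
    rw [hτx]
    exact hxN
  let E : Set (PrimeSpectrum (L ⊗[k] B)) := PrimeSpectrum.basicOpen (∑ i, y (a i) ⊗ₜ[k] b i)
  have hE : ∀ q : PrimeSpectrum (L ⊗[k] B), q ∈ H → (ρ q ∈ D ↔ q ∈ E) := by
    intro q hq
    have h1 := hF (Spec.map τ q) hq
    have h2 : ρ q = μ (Spec.map τ q) := Scheme.Hom.comp_apply _ _ _
    rw [h2]
    refine h1.trans ?_
    change τ.hom F ∉ q.asIdeal ↔ (∑ i, y (a i) ⊗ₜ[k] b i) ∉ q.asIdeal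
    have h3 : τ.hom F = ∑ i, y (a i) ⊗ₜ[k] b i := by
      rw [hFsum, map_sum]
      refine Finset.sum_congr rfl fun i _ => ?_
      simp [τ]
    rw [h3]
  have hpre : ρ ⁻¹' closure D = closure (ρ ⁻¹' D) :=
    hρ.preimage_closure_eq_closure_preimage ρ.continuous D
  have hx1 : ratPt L x ∈ closure (ρ ⁻¹' D) := by
    rw [← hpre]
    change ρ (ratPt L x) ∈ closure D
    rw [hρx]
    exact hcl
  have hx2 : ratPt L x ∈ closure E := by
    have h1 := hH.inter_closure (s := H) (t := ρ ⁻¹' D) ⟨hxH, hx1⟩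
    refine closure_mono ?_ h1
    rintro q ⟨hq1, hq2⟩
    exact (hE q hq1).1 hq2
  have hΩE := hΩ (fun i => y (a i)) hx2
  have hsubD : ρ '' (Ω ∩ H) ⊆ closure D := by
    rintro - ⟨q, ⟨hq1, hq2⟩, rfl⟩
    have h1 := hH.inter_closure (s := H) (t := E) ⟨hq2, hΩE hq1⟩
    change q ∈ ρ ⁻¹' closure D
    rw [hpre]
    refine closure_mono ?_ h1
    rintro q ⟨hq1, hq2⟩
    exact (hE q hq1).2 hq2
  exact Filter.mem_of_superset ((hρ _ (hΩo.inter hH)).mem_nhds ⟨_, ⟨hxΩ, hxH⟩, hρx⟩) hsubD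

end

section

lemma GroupSchemeOver.e_inv {S : Scheme.{u}} (G : GroupSchemeOver S) : G.e ≫ G.inv = G.e := by
  have h1 := G.inv_m G.e (G.inv_over' _)
  have h2 := G.m_one (G.e ≫ G.inv) (𝟙 S) (by rw [G.unit_over, G.inv_over', G.e_sec])
  rw [G.m_congr rfl (Category.id_comp _) _ (by rw [G.inv_over'])] at h2
  rw [← h2, h1, G.e_sec, Category.id_comp]

lemma prop1 {k : Type u} [Field k] (G : GroupSchemeOver (Spec (.of k)))
    {A : CommRingCat.{u}} (j : Spec A ⟶ G.G) [IsOpenImmersion j]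
    (pt : Spec (.of k)) (he : G.e pt ∈ Set.range j) (f : A)
    (hcl : G.e pt ∈ closure (j '' (PrimeSpectrum.basicOpen f : Set (PrimeSpectrum A)))) :
    closure (j '' (PrimeSpectrum.basicOpen f : Set (PrimeSpectrum A))) ∈ nhds (G.e pt) := by
  have he1 : G.e pt ∈ G.inv ⁻¹ᵁ j.opensRange := by
    change G.inv (G.e pt) ∈ Set.range j
    rwa [← Scheme.Hom.comp_apply, G.e_inv]
  obtain ⟨B, j', hj'o, he', hsub⟩ := Scheme.exists_affine_mem_range_and_range_subset he1
  have hsub' : Set.range (j' ≫ G.inv) ⊆ Set.range j := by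
    rintro - ⟨q, rfl⟩
    rw [Scheme.Hom.comp_apply]
    exact hsub ⟨q, rfl⟩
  obtain ⟨ι, hι⟩ := Spec.map_surjective (IsOpenImmersion.lift j (j' ≫ G.inv) hsub')
  have hι' : Spec.map ι ≫ j = j' ≫ G.inv := by rw [hι, IsOpenImmersion.lift_fac]
  obtain ⟨aA, haA⟩ := Spec.map_surjective (j ≫ G.π)
  obtain ⟨aB, haB⟩ := Spec.map_surjective (j' ≫ G.π)
  have hι2 : aA ≫ ι = aB := by
    apply Spec.map_injective
    rw [Spec.map_comp, haA, haB, reassoc_of% hι', G.inv_over]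
  letI : Algebra k A := aA.hom.toAlgebra
  letI : Algebra k B := aB.hom.toAlgebra
  refine prop1_aux (A := A) (B := B) G j j' haA.symm haB.symm
    { ι.hom with commutes' := fun r => ?_ } hι' pt he he' f hcl
  exact congrArg (fun φ => φ.hom r) hι2

lemma prop1' {k : Type u} [Field k] (G : GroupSchemeOver (Spec (.of k)))
    [QuasiSeparatedSpace G.G] (pt : Spec (.of k)) (V : Set G.G) (hV : IsOpen V)
    (hVc : IsCompact V) (hcl : G.e pt ∈ closure V) : closure V ∈ nhds (G.e pt) := by
  obtain ⟨A, j, hjo, he, -⟩ := Scheme.exists_affine_mem_range_and_range_subset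
    (show G.e pt ∈ (⊤ : G.G.Opens) from trivial)
  have hRo : IsOpen (Set.range j) := j.isOpenEmbedding.isOpen_range
  have hRc : IsCompact (Set.range j) := isCompact_range j.continuous
  have h1 : IsCompact (V ∩ Set.range j) :=
    QuasiSeparatedSpace.inter_isCompact V (Set.range j) hV hVc hRo hRc
  have h2 : IsCompact (j ⁻¹' V) := by
    have := j.isOpenEmbedding.isInducing.isCompact_preimage_iff (K := V ∩ Set.range j)
      Set.inter_subset_right
    rw [Set.preimage_inter_range] at this
    exact this.2 h1
  have h3 : IsOpen (j ⁻¹' V) := hV.preimage j.continuous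
  obtain ⟨s, hs, hs2⟩ := isCompact_open_iff_eq_finite_iUnion_of_isTopologicalBasis _
    PrimeSpectrum.isTopologicalBasis_basic_opens PrimeSpectrum.isCompact_basicOpen (j ⁻¹' V) |>.1 ⟨h2, h3⟩
  have h4 : G.e pt ∈ closure (⋃ i ∈ s, j '' (PrimeSpectrum.basicOpen i : Set (PrimeSpectrum A))) := by
    have h5 := hRo.inter_closure (t := V) ⟨he, hcl⟩
    rw [Set.inter_comm, ← Set.image_preimage_eq_inter_range] at h5
    erw [hs2] at h5
    erw [Set.image_iUnion₂] at h5
    exact h5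
  rw [hs.closure_biUnion] at h4
  simp only [Set.mem_iUnion] at h4
  obtain ⟨i, hi, h6⟩ := h4
  refine Filter.mem_of_superset (prop1 G j pt he i h6) (closure_mono ?_)
  rintro - ⟨q, hq, rfl⟩
  change q ∈ j ⁻¹' V
  erw [hs2]
  exact Set.mem_biUnion hi hq

lemma exists_translate {k : Type u} [Field k] (G : GroupSchemeOver (Spec (.of k)))
    [QuasiSeparated G.π] (x : G.G) :
    ∃ (K : Type u) (_ : Field K) (GK : GroupSchemeOver (Spec (.of K))) (θ : GK.G ⟶ G.G)
      (pt : Spec (.of K)), QuasiCompact θ ∧ IsOpenMap θ ∧ θ (GK.e pt) = x ∧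
        QuasiSeparated GK.π := by
  let c := G.G.fromSpecResidueField x
  let t := c ≫ G.π
  have hta : QuasiCompact t := inferInstanceAs (QuasiCompact (c ≫ G.π))
  have hfst : QuasiCompact (pullback.fst G.π t) := inferInstance
  have hop : UniversallyOpen (pullback.fst G.π t) := inferInstance
  have hθ : G.mulR t c rfl = G.transR t c rfl ≫ pullback.fst G.π t := (G.transR_fst t c rfl).symm
  have heθ : pullback.lift (t ≫ G.e) (𝟙 _) (by rw [G.unit_over, Category.id_comp]) ≫
      G.mulR t c rfl = c := by
    rw [G.lift_mulR]
    refine (G.m_congr rfl (Category.id_comp _) _ ?_).trans (G.one_m c t ?_)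
    · exact G.unit_over _
    · exact G.unit_over _
  refine ⟨G.G.residueField x, inferInstance, G.baseChange t, G.mulR t c rfl,
    IsLocalRing.closedPoint (G.G.residueField x), ?_, ?_, ?_, ?_⟩
  · have : QuasiCompact (G.mulR t c rfl) := by rw [hθ]; infer_instance
    exact this
  · have : UniversallyOpen (G.mulR t c rfl) := by rw [hθ]; infer_instance
    exact (G.mulR t c rfl).isOpenMap
  · refine (Scheme.Hom.comp_apply (pullback.lift (t ≫ G.e) (𝟙 _)
      (by rw [G.unit_over, Category.id_comp])) (G.mulR t c rfl) _).symm.trans ?_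
    rw [heθ]
    exact Scheme.fromSpecResidueField_apply _ _
  · exact inferInstanceAs (QuasiSeparated (pullback.snd G.π t))

lemma prop2 {k : Type u} [Field k] (G : GroupSchemeOver (Spec (.of k)))
    [QuasiSeparated G.π] [ConnectedSpace G.G] (V : Set G.G) (hV : IsOpen V) (hne : V.Nonempty) :
    Dense V := by
  obtain ⟨v, hv⟩ := hne
  obtain ⟨U, hU, hvU, hUV⟩ := exists_isAffineOpen_mem_and_subset
    (show v ∈ (⟨V, hV⟩ : G.G.Opens) from hv)
  suffices h : IsOpen (closure (U : Set G.G)) by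
    have h2 : IsClopen (closure (U : Set G.G)) := ⟨isClosed_closure, h⟩
    have h3 := h2.eq_univ ⟨v, subset_closure hvU⟩
    exact Dense.mono hUV (dense_iff_closure_eq.2 h3)
  rw [isOpen_iff_mem_nhds]
  intro x hx
  obtain ⟨K, _, GK, θ, pt, hθq, hθo, hpt, hGKqs⟩ := exists_translate G x
  have hqss : QuasiSeparatedSpace GK.G := quasiSeparatedSpace_of_quasiSeparated GK.π
  have hpre := hθo.preimage_closure_eq_closure_preimage θ.continuous (U : Set G.G)
  have h1 := prop1' GK pt (θ ⁻¹' U) (U.isOpen.preimage θ.continuous)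
    (θ.isCompact_preimage hU.isCompact) (by
      rw [← hpre]
      refine Set.mem_preimage.2 ?_
      rw [hpt]; exact hx)
  have h2 := hθo.image_mem_nhds h1
  rw [hpt] at h2
  refine Filter.mem_of_superset h2 ?_
  rintro - ⟨q, hq, rfl⟩
  rw [← hpre] at hq
  exact hq

end

section

/-- The coincidence locus of two morphisms into a separated scheme is closed. -/
lemma exists_closed_equalizer {W U S : Scheme.{u}} (α β : W ⟶ U) (v : U ⟶ S) [IsSeparated v]
    (h : α ≫ v = β ≫ v) :
    ∃ (Z : Scheme.{u}) (i : Z ⟶ W), IsClosed (Set.range i) ∧ i ≫ α = i ≫ β ∧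
      ∀ (T : Scheme.{u}) (f : T ⟶ W), f ≫ α = f ≫ β → Set.range f ⊆ Set.range i := by
  let d : W ⟶ pullback v v := pullback.lift α β h
  let i := pullback.fst d (pullback.diagonal v)
  have hcl : IsClosedImmersion (pullback.diagonal v) := IsSeparated.isClosedImmersion_diagonal
  have hi : IsClosedImmersion i := MorphismProperty.of_isPullback
    (P := @IsClosedImmersion) (IsPullback.of_hasPullback d (pullback.diagonal v)).flip hcl
  refine ⟨_, i, i.isClosedEmbedding.isClosed_range, ?_, ?_⟩
  · have h1 : i ≫ d = _ := pullback.condition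
    have h2 := congrArg (fun z => z ≫ pullback.fst v v) h1
    have h3 := congrArg (fun z => z ≫ pullback.snd v v) h1
    simp only [Category.assoc, d, pullback.lift_fst, pullback.lift_snd,
      pullback.diagonal_fst, pullback.diagonal_snd, Category.comp_id] at h2 h3
    rw [h2, h3]
  · intro T f hf
    have hl : f ≫ d = (f ≫ α) ≫ pullback.diagonal v := by
      apply pullback.hom_ext
      · simp [d, pullback.lift_fst]
      · simp [d, pullback.lift_snd, hf]
    have : f = pullback.lift f (f ≫ α) hl ≫ i := (pullback.lift_fst _ _ _).symm
    rw [this]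
    rintro - ⟨q, rfl⟩
    rw [Scheme.Hom.comp_apply]
    exact ⟨_, rfl⟩

namespace GroupSchemeOver

variable {S : Scheme.{u}} (G : GroupSchemeOver S)

lemma eq_of_inv_m {T : Scheme.{u}} (a b : T ⟶ G.G) (t : T ⟶ S) (hab : a ≫ G.π = b ≫ G.π)
    (h : G.m (a ≫ G.inv) b ((G.inv_over' a).trans hab) = t ≫ G.e) : a = b := by
  have h1 := G.m_assoc a (a ≫ G.inv) b (G.inv_over' a).symm ((G.inv_over' a).trans hab)
  have ht : t = a ≫ G.π := by
    rw [← G.unit_over t, ← h, m_over, inv_over']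
  rw [G.m_congr (G.m_inv a _) rfl _ (by rw [unit_over, hab]), one_m,
    G.m_congr rfl h _ (by rw [unit_over, ht]), m_one] at h1
  exact h1.symm

lemma eq_unit_of_m {T : Scheme.{u}} (a b : T ⟶ G.G) (hab : a ≫ G.π = b ≫ G.π)
    (h : G.m a b hab = a) : b = (a ≫ G.π) ≫ G.e := by
  have h1 := G.m_assoc (a ≫ G.inv) a b (G.inv_over' a) hab
  rw [G.m_congr (G.inv_m a _) rfl _ (by rw [unit_over, hab]), one_m,
    G.m_congr rfl h _ (by rw [inv_over']), inv_m] at h1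
  exact h1

/-- The diagonal is a base change of the unit section. -/
lemma isPullback_diagonal :
    IsPullback (pullback.diagonal G.π) G.π
      (G.m (pullback.fst G.π G.π ≫ G.inv) (pullback.snd G.π G.π)
        (by rw [inv_over', pullback.condition])) G.e := by
  refine IsPullback.of_isLimit' ⟨?_⟩ (PullbackCone.IsLimit.mk _
    (fun s => s.fst ≫ pullback.fst _ _) ?_ ?_ ?_)
  · rw [G.comp_m _ _ _ _ (by simp [G.inv_over])]
    refine (G.m_congr (a' := 𝟙 _ ≫ G.inv) (b' := 𝟙 _) (by simp) (by simp) _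
      (by simp [G.inv_over])).trans ?_
    rw [inv_m, Category.id_comp]
  · intro s
    have hc := s.condition
    have hab : (s.fst ≫ pullback.fst _ _) ≫ G.π = (s.fst ≫ pullback.snd _ _) ≫ G.π := by
      simp [pullback.condition]
    have h1 : s.fst ≫ pullback.fst _ _ = s.fst ≫ pullback.snd _ _ := by
      refine G.eq_of_inv_m _ _ s.snd hab ?_
      rw [← hc, G.comp_m _ _ _ _ (by simp [G.inv_over, pullback.condition])]
      exact G.m_congr (by simp) rfl _ _
    apply pullback.hom_ext
    · simp
    · simp [h1]
  · intro s
    have hc := congrArg (fun z => z ≫ G.π) s.condition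
    simp only [Category.assoc, G.e_sec, Category.comp_id, m_over, G.inv_over] at hc
    simpa using hc
  · intro s f hf1 hf2
    rw [← hf1]
    simp

lemma isSeparated_of_isClosedImmersion_e (h : IsClosedImmersion G.e) : IsSeparated G.π :=
  ⟨MorphismProperty.of_isPullback (P := @IsClosedImmersion) G.isPullback_diagonal.flip h⟩

end GroupSchemeOver

end

section

lemma flat_of_schemeFlat {X S : Scheme.{u}} (f : X ⟶ S) (h : SchemeFlat f) : Flat f :=
  Flat.of_stalkMap f fun x => h x

/-- Every point `c0` of `G` is the second coordinate of a point `(g, c0)` with `g ∈ U` and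
`g c0 ∈ U`, for `U` an open neighbourhood of the unit. -/
lemma exists_point {S : Scheme.{u}} (G : GroupSchemeOver S)
    (hconn : ∀ s : S, _root_.IsConnected (G.π ⁻¹' {s})) (hqs : QuasiSeparated G.π)
    (c0 : G.G) (U : G.G.Opens) (hU : G.e (G.π c0) ∈ U) :
    ∃ w : (pullback G.π G.π : Scheme.{u}), pullback.snd G.π G.π w = c0 ∧
      pullback.fst G.π G.π w ∈ U ∧
      G.m (pullback.fst G.π G.π) (pullback.snd G.π G.π) pullback.condition w ∈ U := by
  let s0 := G.π c0
  let t0 := S.fromSpecResidueField s0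
  let c := G.G.fromSpecResidueField c0
  let t' := Spec.map (G.π.residueFieldMap c0)
  have ht : t' ≫ t0 = c ≫ G.π := Scheme.Hom.SpecMap_residueFieldMap_fromSpecResidueField G.π c0
  let t := c ≫ G.π
  -- the fibre is irreducible
  have hconnF : ConnectedSpace (pullback G.π t0 : Scheme.{u}) := by
    have h1 : ConnectedSpace (G.π ⁻¹' {s0}) := isConnected_iff_connectedSpace.1 (hconn s0)
    have h2 := (G.π.fiberHomeo s0).symm
    exact h2.surjective.connectedSpace h2.continuous
  have hqsF : QuasiSeparated (pullback.snd G.π t0) := inferInstance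
  have hdense : ∀ V : Set (pullback G.π t0 : Scheme.{u}), IsOpen V → V.Nonempty → Dense V :=
    fun V hV hne =>
      haveI : ConnectedSpace (G.baseChange t0).G := hconnF
      haveI : QuasiSeparated (G.baseChange t0).π := hqsF
      prop2 (k := S.residueField s0) (G.baseChange t0) V hV hne
  -- the base change to the residue field of `c0`
  have hrw : pullback.fst G.π t ≫ G.π = (pullback.snd G.π t ≫ t') ≫ t0 := by
    rw [Category.assoc, ht, pullback.condition]
  let r : pullback G.π t ⟶ pullback G.π t0 :=
    pullback.lift (pullback.fst G.π t) (pullback.snd G.π t ≫ t') hrw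
  have hr : IsPullback r (pullback.snd G.π t) (pullback.snd G.π t0) t' := by
    have h1 : r ≫ pullback.fst G.π t0 = pullback.fst G.π t := pullback.lift_fst _ _ _
    have h2 : r ≫ pullback.snd G.π t0 = pullback.snd G.π t ≫ t' := pullback.lift_snd _ _ _
    have h3 : IsPullback (r ≫ pullback.fst G.π t0) (pullback.snd G.π t) G.π (t' ≫ t0) := by
      rw [h1, ht]
      exact IsPullback.of_hasPullback G.π t
    exact IsPullback.of_right h3 h2 (IsPullback.of_hasPullback G.π t0)
  have hro : UniversallyOpen r :=
    MorphismProperty.of_isPullback (P := @UniversallyOpen) hr.flip inferInstance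
  have hrfst : r ≫ pullback.fst G.π t0 = pullback.fst G.π t := pullback.lift_fst _ _ _
  let V : Set (pullback G.π t : Scheme.{u}) := pullback.fst G.π t ⁻¹' U
  have hVo : IsOpen V := U.isOpen.preimage (pullback.fst G.π t).continuous
  let pt : Spec (G.G.residueField c0) := IsLocalRing.closedPoint (G.G.residueField c0)
  let el : Spec (G.G.residueField c0) ⟶ pullback G.π t :=
    pullback.lift (t ≫ G.e) (𝟙 _) (by rw [G.unit_over, Category.id_comp])
  have hel : el pt ∈ V := by
    change pullback.fst G.π t (el pt) ∈ U
    rw [← Scheme.Hom.comp_apply, pullback.lift_fst, Scheme.Hom.comp_apply, Scheme.Hom.comp_apply]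
    have : c pt = c0 := Scheme.fromSpecResidueField_apply _ _
    rw [this]
    exact hU
  have hVd : Dense V := by
    have h1 : V = r ⁻¹' (pullback.fst G.π t0 ⁻¹' U) := by
      ext q
      change pullback.fst G.π t q ∈ U ↔ pullback.fst G.π t0 (r q) ∈ U
      rw [← hrfst, Scheme.Hom.comp_apply]
    rw [h1]
    refine (hdense _ (U.isOpen.preimage (pullback.fst G.π t0).continuous) ⟨r (el pt), ?_⟩).preimage
      r.isOpenMap
    have h2 := hel
    rw [h1] at h2
    exact h2
  let σ := G.transR t c rfl
  have hσ : Function.Surjective σ := σ.surjective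
  obtain ⟨q1, hq1⟩ := hσ (el pt)
  obtain ⟨q, hq2, hqV⟩ := hVd.inter_open_nonempty (σ ⁻¹' V) (hVo.preimage σ.continuous)
    ⟨q1, by rw [Set.mem_preimage, hq1]; exact hel⟩
  have hν : pullback.fst G.π t ≫ G.π = (pullback.snd G.π t ≫ c) ≫ G.π := by
    rw [pullback.condition, Category.assoc]
  let ν : pullback G.π t ⟶ pullback G.π G.π :=
    pullback.lift (pullback.fst G.π t) (pullback.snd G.π t ≫ c) hν
  refine ⟨ν q, ?_, ?_, ?_⟩
  · rw [← Scheme.Hom.comp_apply, pullback.lift_snd, Scheme.Hom.comp_apply]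
    exact Scheme.fromSpecResidueField_apply _ _
  · rw [← Scheme.Hom.comp_apply, pullback.lift_fst]
    exact hqV
  · have h1 : ν ≫ G.m (pullback.fst G.π G.π) (pullback.snd G.π G.π) pullback.condition =
        σ ≫ pullback.fst G.π t := by
      rw [G.transR_fst, G.comp_m _ _ _ _ (by simp [ν, pullback.condition])]
      exact G.m_congr (pullback.lift_fst _ _ _) (pullback.lift_snd _ _ _) _ _
    rw [← Scheme.Hom.comp_apply, h1, Scheme.Hom.comp_apply]
    exact hq2

end

section

/-- Small affine neighbourhoods of a point are separated over the base. -/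
lemma exists_separated_nhd {X S : Scheme.{u}} (f : X ⟶ S) (x : X) :
    ∃ U : X.Opens, x ∈ U ∧ IsSeparated (U.ι ≫ f) := by
  obtain ⟨S0, hS0, hx0, -⟩ := exists_isAffineOpen_mem_and_subset (X := S) (x := f x) (U := ⊤) trivial
  obtain ⟨U, hU, hxU, hle⟩ := exists_isAffineOpen_mem_and_subset (X := X) (x := x)
    (U := f ⁻¹ᵁ S0) hx0
  refine ⟨U, hxU, ?_⟩
  rw [← Scheme.Hom.resLE_comp_ι f (e := hle)]
  haveI : IsAffine U := hU
  haveI : IsAffine S0 := hS0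
  infer_instance

lemma isClosedImmersion_e {S : Scheme.{u}} (G : GroupSchemeOver S)
    (hconn : ∀ s : S, _root_.IsConnected (G.π ⁻¹' {s})) (hqs : QuasiSeparated G.π)
    (hflat : Flat G.π) : IsClosedImmersion G.e := by
  have himm : IsImmersion G.e := by
    haveI : IsImmersion (G.e ≫ G.π) := by rw [G.e_sec]; infer_instance
    exact IsImmersion.of_comp G.e G.π
  have hqc : QuasiCompact G.e := by
    haveI : QuasiCompact (G.e ≫ G.π) := by rw [G.e_sec]; infer_instance
    exact QuasiCompact.of_comp G.e G.π
  have hπe : ∀ s : S, G.π (G.e s) = s := fun s => by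
    rw [← Scheme.Hom.comp_apply, G.e_sec]; rfl
  have hspec : SpecializingMap G.e := by
    rintro s1 c0 hs
    obtain ⟨U, heU, hsep⟩ := exists_separated_nhd G.π (G.e (G.π c0))
    obtain ⟨w0, hw0c, hw0U, hw0m⟩ := exists_point G hconn hqs c0 U heU
    let p := pullback.fst G.π G.π
    let q := pullback.snd G.π G.π
    let μ := G.m p q pullback.condition
    have hfl : Flat q := inferInstance
    obtain ⟨w1, hw1, hw1e⟩ := Flat.generalizingMap q (a := w0) (b := G.e s1)
      (by change G.e s1 ⤳ q w0; rw [hw0c]; exact hs)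
    let W : (pullback G.π G.π : Scheme.{u}).Opens := p ⁻¹ᵁ U ⊓ μ ⁻¹ᵁ U
    have hw0W : w0 ∈ W := ⟨hw0U, hw0m⟩
    have hw1W : w1 ∈ W := hw1.mem_open W.isOpen hw0W
    have hα : Set.range (W.ι ≫ p) ⊆ Set.range U.ι := by
      rintro - ⟨x, rfl⟩
      rw [Scheme.Hom.comp_apply, Scheme.Opens.range_ι]
      exact x.2.1
    have hβ : Set.range (W.ι ≫ μ) ⊆ Set.range U.ι := by
      rintro - ⟨x, rfl⟩
      rw [Scheme.Hom.comp_apply, Scheme.Opens.range_ι]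
      exact x.2.2
    let α := IsOpenImmersion.lift U.ι (W.ι ≫ p) hα
    let β := IsOpenImmersion.lift U.ι (W.ι ≫ μ) hβ
    have hαf : α ≫ U.ι = W.ι ≫ p := IsOpenImmersion.lift_fac _ _ _
    have hβf : β ≫ U.ι = W.ι ≫ μ := IsOpenImmersion.lift_fac _ _ _
    have hαβ : α ≫ U.ι ≫ G.π = β ≫ U.ι ≫ G.π := by
      rw [← Category.assoc, ← Category.assoc, hαf, hβf, Category.assoc, Category.assoc, G.m_over]
    obtain ⟨Z, i, hZ, hi, huniv⟩ := exists_closed_equalizer α β (U.ι ≫ G.π) hαβ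
    -- `w1` lies in the coincidence locus
    have hw1Z : (⟨w1, hw1W⟩ : W) ∈ Set.range i := by
      obtain ⟨z, hz1, -⟩ := Scheme.Pullback.exists_preimage_pullback
        (f := W.ι ≫ q) (g := G.e) (⟨w1, hw1W⟩ : W) s1 hw1e
      refine huniv _ (pullback.fst (W.ι ≫ q) G.e) ?_ ⟨z, hz1⟩
      rw [← cancel_mono U.ι, Category.assoc, Category.assoc, hαf, hβf]
      have hcond := pullback.condition (f := W.ι ≫ q) (g := G.e)
      rw [← Category.assoc, ← Category.assoc]
      have hpq : p ≫ G.π = q ≫ G.π := pullback.condition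
      rw [G.comp_m _ p q _ (by simp only [Category.assoc, hpq])]
      have h2 : (pullback.fst (W.ι ≫ q) G.e ≫ W.ι) ≫ q = pullback.snd (W.ι ≫ q) G.e ≫ G.e := by
        rw [Category.assoc, hcond]
      refine ((G.m_congr rfl h2 _ ?_).trans (G.m_one _ _ ?_)).symm <;>
      · rw [← h2]; simp only [Category.assoc, hpq]
    have hsp : (⟨w1, hw1W⟩ : W) ⤳ ⟨w0, hw0W⟩ := Topology.IsInducing.subtypeVal.specializes_iff.1 hw1
    obtain ⟨z, hz⟩ := hsp.mem_closed hZ hw1Z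
    have hpq : p ≫ G.π = q ≫ G.π := pullback.condition
    have hZe : G.m ((i ≫ W.ι) ≫ p) ((i ≫ W.ι) ≫ q)
        (by simp only [Category.assoc, hpq]) = (i ≫ W.ι) ≫ p := by
      rw [← G.comp_m _ p q pullback.condition, Category.assoc, Category.assoc]
      change i ≫ W.ι ≫ μ = _
      rw [← hαf, ← hβf, ← Category.assoc, ← Category.assoc, hi]
    have hq := G.eq_unit_of_m _ _ _ hZe
    have hz0 : (i ≫ W.ι) z = w0 := by rw [Scheme.Hom.comp_apply, hz]; rfl
    have hc : c0 = G.e (G.π (p w0)) := by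
      have h1 : ((i ≫ W.ι) ≫ q) z = ((((i ≫ W.ι) ≫ p) ≫ G.π) ≫ G.e) z := by rw [hq]
      rw [Scheme.Hom.comp_apply, Scheme.Hom.comp_apply _ G.e, Scheme.Hom.comp_apply _ G.π,
        Scheme.Hom.comp_apply _ p, hz0, hw0c] at h1
      exact h1
    refine ⟨G.π (p w0), ?_, hc.symm⟩
    have h2 := hs.map G.π.continuous
    rw [hπe, hc, hπe] at h2
    exact h2
  have hrange : IsClosed (Set.range G.e) :=
    ((isClosedMap_iff_specializingMap G.e).2 hspec).isClosed_range
  exact IsClosedImmersion.of_isPreimmersion G.e hrange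

end

/-- Lemma 5.11 of the paper.  A quasi-separated flat group scheme over
a base `S` with connected fibres is separated over `S`. -/
theorem group_scheme_with_connected_fibres_separated
    {S : Scheme.{u}} (G : GroupSchemeOver S)
    (hconn : ∀ s : S, _root_.IsConnected (G.π.base ⁻¹' {s}))
    (hqs : QuasiSeparated G.π) (hflat : SchemeFlat G.π) :
    IsSeparated G.π := by
  exact G.isSeparated_of_isClosedImmersion_e
    (isClosedImmersion_e G hconn hqs (flat_of_schemeFlat G.π hflat))

end NeronSemistable
end
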